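/- Let d ≥ 1 and let φ : ℕ → [0,∞] satisfy φ(0)=0 and φ nondecreasing (condition (N)), and assume either: (i) the repulsive condition (R) and h ∈ ℝ^d \ {0}, or (ii) the attractive condition (A) with normalisation (SL) and h ∉ K_{λ₀}. Then the measures P_n^h concentrate on ballistic trajectories: there exist v̄ = v̄_h ∈ ℝ^d \ {0}, a constant κ > 0 and ε ∈ (0, ‖v̄_h‖) such that for all n, P_n^h( D(γ)/n ∉ B_ε(v̄) ) ≤ e^{−κn}, where B_ε(v̄) = {u : |u − v̄| < ε}. -/

import Mathlib

open scoped BigOperators ENNReal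
open Filter Topology

noncomputable section

namespace SIRW

abbrev Pt (d : ℕ) := Fin d → ℤ

variable {d : ℕ}

/-- A step of a nearest-neighbour walk: a vector of ℓ¹-norm one. -/
def IsStep (s : Pt d) : Prop := (∑ i, |s i|) = 1

/-- A nearest-neighbour path started at the origin, encoded by its list of steps. -/
def IsPath (γ : List (Pt d)) : Prop := ∀ s ∈ γ, IsStep s

/-- Position of the path after `k` steps (the path starts at the origin). -/
def pos (γ : List (Pt d)) (k : ℕ) : Pt d := (γ.take k).sum

/-- Displacement `D(γ) = γ(n) - γ(0)`. -/
def disp (γ : List (Pt d)) : Pt d := γ.sum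

/-- Local time of the path at the site `x`. -/
def locTime (γ : List (Pt d)) (x : Pt d) : ℕ :=
  ((Finset.range (γ.length + 1)).filter (fun k => pos γ k = x)).card

/-- The (finite) set of sites visited by the path. -/
def visited (γ : List (Pt d)) : Finset (Pt d) :=
  (Finset.range (γ.length + 1)).image (pos γ)

/-- Site potential `Φ(γ) = ∑_x φ(l_x(γ))`, for `φ : ℕ → [0,∞]` with `φ 0 = 0`. -/
def PotE (φ : ℕ → ℝ≥0∞) (γ : List (Pt d)) : ℝ≥0∞ :=
  ∑ x ∈ visited γ, φ (locTime γ x)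

/-- Site potential `Φ(γ) = ∑_x φ(l_x(γ))`, for real-valued `φ` with `φ 0 = 0`. -/
def PotR (φ : ℕ → ℝ) (γ : List (Pt d)) : ℝ :=
  ∑ x ∈ visited γ, φ (locTime γ x)

/-- `e^{-a}` for `a ∈ [0,∞]`, with `e^{-∞} = 0`. -/
def expNegE (a : ℝ≥0∞) : ℝ≥0∞ :=
  if a = ⊤ then 0 else ENNReal.ofReal (Real.exp (-a.toReal))

/-- `e^{a}` for `a ∈ [0,∞]`, with `e^{∞} = ∞`. -/
def expE (a : ℝ≥0∞) : ℝ≥0∞ :=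
  if a = ⊤ then ⊤ else ENNReal.ofReal (Real.exp a.toReal)

/-- Weight `W_λ(γ) = e^{-Φ(γ) - λ|γ|}` (extended-real-valued potential). -/
def wE (φ : ℕ → ℝ≥0∞) (lam : ℝ) (γ : List (Pt d)) : ℝ≥0∞ :=
  expNegE (PotE φ γ) * ENNReal.ofReal (Real.exp (-(lam * γ.length)))

/-- Weight `W_λ(γ) = e^{-Φ(γ) - λ|γ|}` (real-valued potential). -/
def wR (φ : ℕ → ℝ) (lam : ℝ) (γ : List (Pt d)) : ℝ≥0∞ :=
  ENNReal.ofReal (Real.exp (-PotR φ γ - lam * γ.length))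

/-- The set of `n`-step nearest-neighbour paths started at the origin. -/
def PathsN (d n : ℕ) : Set (List (Pt d)) := {γ | IsPath γ ∧ γ.length = n}

/-- Partition function `Z_n` (extended-real-valued potential). -/
def ZE (d : ℕ) (φ : ℕ → ℝ≥0∞) (n : ℕ) : ℝ≥0∞ :=
  ∑' γ : PathsN d n, expNegE (PotE φ (γ : List (Pt d)))

/-- Partition function `Z_n` (real-valued potential). -/
def ZR (d : ℕ) (φ : ℕ → ℝ) (n : ℕ) : ℝ≥0∞ :=
  ∑' γ : PathsN d n, ENNReal.ofReal (Real.exp (-PotR φ (γ : List (Pt d))))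

/-- Paths from `0` to `x`. -/
def Dpaths (x : Pt d) : Set (List (Pt d)) := {γ | IsPath γ ∧ disp γ = x}

/-- Paths from `0` to `x` hitting `x` only at their final point. -/
def Hpaths (x : Pt d) : Set (List (Pt d)) := {γ | IsPath γ ∧ disp γ = x ∧ locTime γ x = 1}

/-- Two-point function `D_λ(x)` (extended-real-valued potential). -/
def DEf (φ : ℕ → ℝ≥0∞) (lam : ℝ) (x : Pt d) : ℝ≥0∞ :=
  ∑' γ : Dpaths x, wE φ lam (γ : List (Pt d))

/-- Two-point function `H_λ(x)` (extended-real-valued potential). -/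
def HEf (φ : ℕ → ℝ≥0∞) (lam : ℝ) (x : Pt d) : ℝ≥0∞ :=
  ∑' γ : Hpaths x, wE φ lam (γ : List (Pt d))

/-- Two-point function `D_λ(x)` (real-valued potential). -/
def DRf (φ : ℕ → ℝ) (lam : ℝ) (x : Pt d) : ℝ≥0∞ :=
  ∑' γ : Dpaths x, wR φ lam (γ : List (Pt d))

/-- Two-point function `H_λ(x)` (real-valued potential). -/
def HRf (φ : ℕ → ℝ) (lam : ℝ) (x : Pt d) : ℝ≥0∞ :=
  ∑' γ : Hpaths x, wR φ lam (γ : List (Pt d))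

/-- Coercion of a lattice point to a real vector. -/
def ctR (x : Pt d) : Fin d → ℝ := fun i => (x i : ℝ)

/-- Componentwise floor `⌊M x⌋`. -/
def flr (M : ℝ) (x : Fin d → ℝ) : Pt d := fun i => ⌊M * x i⌋

/-- Euclidean scalar product on `ℝ^d`. -/
def inr (h x : Fin d → ℝ) : ℝ := ∑ i, h i * x i

/-- Euclidean norm on `ℝ^d`. -/
def nrm (x : Fin d → ℝ) : ℝ := Real.sqrt (∑ i, x i ^ 2)

/-- Wulff shape `K = {h : (h,x) ≤ ξ(x) ∀x}` associated with a norm `ξ`. -/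
def Kset (ξ : (Fin d → ℝ) → ℝ) : Set (Fin d → ℝ) := {h | ∀ x, inr h x ≤ ξ x}

/-- Weight `W_h(γ) = e^{-Φ(γ) + (h, D(γ))}` (extended-real-valued potential). -/
def wHE (φ : ℕ → ℝ≥0∞) (h : Fin d → ℝ) (γ : List (Pt d)) : ℝ≥0∞ :=
  expNegE (PotE φ γ) * ENNReal.ofReal (Real.exp (inr h (ctR (disp γ))))

/-- Partition function `Z_n^h` with drift `h` (extended-real-valued potential). -/
def ZHE (d : ℕ) (φ : ℕ → ℝ≥0∞) (h : Fin d → ℝ) (n : ℕ) : ℝ≥0∞ :=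
  ∑' γ : PathsN d n, wHE φ h (γ : List (Pt d))

/-- Weight `W_h(γ) = e^{-Φ(γ) + (h, D(γ))}` (real-valued potential). -/
def wHR (φ : ℕ → ℝ) (h : Fin d → ℝ) (γ : List (Pt d)) : ℝ≥0∞ :=
  ENNReal.ofReal (Real.exp (-PotR φ γ + inr h (ctR (disp γ))))

/-- Partition function `Z_n^h` with drift `h` (real-valued potential). -/
def ZHR (d : ℕ) (φ : ℕ → ℝ) (h : Fin d → ℝ) (n : ℕ) : ℝ≥0∞ :=
  ∑' γ : PathsN d n, wHR φ h (γ : List (Pt d))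

/-- Condition (SL) for an extended-real-valued potential: finiteness and sublinearity. -/
def SLE (φ : ℕ → ℝ≥0∞) : Prop :=
  (∀ n, φ n ≠ ⊤) ∧ Tendsto (fun n : ℕ => (φ n).toReal / n) atTop (𝓝 0)

/-- Forward cone `Y^>_δ(h) = {y : s_h(y) < δ ξ(y)}`, where `s_h(y) = ξ(y) - (h,y)`. -/
def Ygt (ξ : (Fin d → ℝ) → ℝ) (h : Fin d → ℝ) (δ : ℝ) : Set (Pt d) :=
  {y | ξ (ctR y) - inr h (ctR y) < δ * ξ (ctR y)}

/-- `γ(k)` is an `(h,δ)`-cone point of `γ`: the whole path lies in the union of the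
forward and backward cones of aperture `3δ` centred at `γ(k)`. -/
def IsConePt (ξ : (Fin d → ℝ) → ℝ) (h : Fin d → ℝ) (δ : ℝ) (γ : List (Pt d)) (k : ℕ) : Prop :=
  k ≤ γ.length ∧ ∀ j ≤ γ.length, j ≠ k →
    ((pos γ j - pos γ k) ∈ Ygt ξ h (3 * δ) ∨ (pos γ k - pos γ j) ∈ Ygt ξ h (3 * δ))

open scoped Classical in
/-- The number of `(h,δ)`-cone points of the path `γ`. -/
def coneCount (ξ : (Fin d → ℝ) → ℝ) (h : Fin d → ℝ) (δ : ℝ) (γ : List (Pt d)) : ℕ :=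
  ((Finset.range (γ.length + 1)).filter (fun k => IsConePt ξ h δ γ k)).card

/-- Unoriented edges traversed by the path `γ` started at the point `a`. -/
def pathEdges (a : Pt d) (γ : List (Pt d)) : Set (Sym2 (Pt d)) :=
  {e | ∃ k < γ.length, e = s(a + pos γ k, a + pos γ (k + 1))}

/-- Starting point of the `i`-th piece in the concatenation of the paths `γv 0, …, γv (m-1)`. -/
def famStart {m : ℕ} (γv : Fin m → List (Pt d)) (i : Fin m) : Pt d :=
  ∑ j ∈ Finset.univ.filter (fun j : Fin m => j < i), disp (γv j)

/-- The pieces `γv 0, …, γv (m-1)` of a concatenation are edge-disjoint. -/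
def EdgeDisjointFam {m : ℕ} (γv : Fin m → List (Pt d)) : Prop :=
  ∀ i j : Fin m, i ≠ j →
    Disjoint (pathEdges (famStart γv i) (γv i)) (pathEdges (famStart γv j) (γv j))

/-- Concatenation `γ₁ ∪ ⋯ ∪ γ_m` of paths (as step lists). -/
def concatFam {m : ℕ} (γv : Fin m → List (Pt d)) : List (Pt d) := (List.ofFn γv).flatten

/-- Perturbed weight `e^{-Φ(γ) - R(γ,g) + (g, D(γ))}`. -/
def wPert (φ : ℕ → ℝ≥0∞) (Rp : List (Pt d) → (Fin d → ℝ) → ℝ) (g : Fin d → ℝ)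
    (γ : List (Pt d)) : ℝ≥0∞ :=
  expNegE (PotE φ γ) * ENNReal.ofReal (Real.exp (-Rp γ g + inr g (ctR (disp γ))))

/-- Perturbed partition function `Z̃_n^g`. -/
def ZPert (d : ℕ) (φ : ℕ → ℝ≥0∞) (Rp : List (Pt d) → (Fin d → ℝ) → ℝ)
    (g : Fin d → ℝ) (n : ℕ) : ℝ≥0∞ :=
  ∑' γ : PathsN d n, wPert φ Rp g (γ : List (Pt d))

/-- The segment of `γ` of length `p` started at time `l` matches the pattern
`(u 0, …, u p)` up to a shift. -/
def patMatch (u : ℕ → Pt d) (p : ℕ) (γ : List (Pt d)) (l : ℕ) : Prop :=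
  ∀ j ≤ p, pos γ (l + j) - pos γ l = u j - u 0

open scoped Classical in
/-- Number of occurrences `N_η(γ)` of the pattern `η = (u 0, …, u p)` in `γ`. -/
def Npat (u : ℕ → Pt d) (p : ℕ) (γ : List (Pt d)) : ℕ :=
  ((Finset.range (γ.length + 1 - p)).filter (fun l => patMatch u p γ l)).card

/-- The gradient vector of `f : ℝ^d → ℝ` at `g`. -/
def gradVec (f : (Fin d → ℝ) → ℝ) (g : Fin d → ℝ) : Fin d → ℝ :=
  fun i => fderiv ℝ f g (Pi.single i 1)

end SIRW

open SIRW

section Aux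
variable {d : ℕ}

/-- potential of a multiset of sites -/
def pot (φ : ℕ → ℝ≥0∞) (s : Multiset (Pt d)) : ℝ≥0∞ := ∑ x ∈ s.toFinset, φ (s.count x)

/-- visited sites after time zero -/
def visT : List (Pt d) → Multiset (Pt d)
  | [] => 0
  | s :: γ => s ::ₘ (visT γ).map (fun x => s + x)

/-- all visited sites -/
def vis (γ : List (Pt d)) : Multiset (Pt d) := 0 ::ₘ visT γ

lemma visT_cons (s : Pt d) (γ : List (Pt d)) : visT (s :: γ) = (vis γ).map (fun x => s + x) := by
  simp [vis, visT]

lemma vis_eq (γ : List (Pt d)) : vis γ = (Multiset.range (γ.length + 1)).map (pos γ) := by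
  induction γ with
  | nil => simp [vis, visT, pos]
  | cons s γ ih =>
    rw [vis, visT_cons, ih, List.length_cons]
    have : Multiset.range (γ.length + 1 + 1) = 0 ::ₘ (Multiset.range (γ.length + 1)).map (fun k => k + 1) := by
      simp only [Multiset.range, Multiset.map_coe]
      rw [List.range_succ_eq_map]
      rfl
    rw [this, Multiset.map_cons, Multiset.map_map, Multiset.map_map]
    congr 1
    

lemma PotE_eq (φ : ℕ → ℝ≥0∞) (γ : List (Pt d)) : PotE φ γ = pot φ (vis γ) := by
  unfold PotE pot
  have h1 : visited γ = (vis γ).toFinset := by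
    ext x
    simp only [visited, vis_eq, Finset.mem_image, Finset.mem_range, Multiset.mem_toFinset,
      Multiset.mem_map, Multiset.mem_range]
  rw [h1]
  refine Finset.sum_congr rfl fun x _ => ?_
  congr 1
  rw [vis_eq, Multiset.count_map]
  unfold locTime
  rw [Finset.card_def, Finset.filter_val]
  congr 1
  refine Multiset.filter_congr ?_
  intro k _
  exact eq_comm

lemma pot_eq {φ : ℕ → ℝ≥0∞} (h0 : φ 0 = 0) {s : Multiset (Pt d)} {T : Finset (Pt d)}
    (hT : s.toFinset ⊆ T) : pot φ s = ∑ x ∈ T, φ (s.count x) := by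
  unfold pot
  refine Finset.sum_subset hT ?_
  intro x _ hx
  rw [Multiset.count_eq_zero_of_notMem (by simpa using hx), h0]

lemma pot_mono {φ : ℕ → ℝ≥0∞} (h0 : φ 0 = 0) (hm : Monotone φ) {s t : Multiset (Pt d)}
    (h : s ≤ t) : pot φ s ≤ pot φ t := by
  rw [pot_eq h0 (T := t.toFinset) (Multiset.toFinset_subset.2 (Multiset.subset_of_le h))]
  exact Finset.sum_le_sum fun x _ => hm (Multiset.count_le_of_le x h)

lemma pot_addR {φ : ℕ → ℝ≥0∞} (h0 : φ 0 = 0) (hR : ∀ l m : ℕ, φ l + φ m ≤ φ (l + m))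
    (s t : Multiset (Pt d)) : pot φ s + pot φ t ≤ pot φ (s + t) := by
  rw [pot_eq h0 (s := s) (T := (s+t).toFinset) (by simp),
    pot_eq h0 (s := t) (T := (s+t).toFinset) (by simp), pot, ← Finset.sum_add_distrib]
  refine Finset.sum_le_sum fun x _ => ?_
  rw [Multiset.count_add]
  exact hR _ _

lemma pot_addA {φ : ℕ → ℝ≥0∞} (h0 : φ 0 = 0) (hA : ∀ l m : ℕ, φ (l + m) ≤ φ l + φ m)
    (s t : Multiset (Pt d)) : pot φ (s + t) ≤ pot φ s + pot φ t := by
  rw [pot_eq h0 (s := s) (T := (s+t).toFinset) (by simp),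
    pot_eq h0 (s := t) (T := (s+t).toFinset) (by simp), pot, ← Finset.sum_add_distrib]
  refine Finset.sum_le_sum fun x _ => ?_
  rw [Multiset.count_add]
  exact hA _ _

lemma pot_addD {φ : ℕ → ℝ≥0∞} (h0 : φ 0 = 0)
    (s t : Multiset (Pt d)) (hd : ∀ x ∈ s, x ∉ t) : pot φ (s + t) = pot φ s + pot φ t := by
  rw [pot_eq h0 (s := s) (T := (s+t).toFinset) (by simp),
    pot_eq h0 (s := t) (T := (s+t).toFinset) (by simp), pot, ← Finset.sum_add_distrib]
  refine Finset.sum_congr rfl fun x _ => ?_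
  rw [Multiset.count_add]
  by_cases hx : x ∈ s
  · rw [Multiset.count_eq_zero_of_notMem (hd x hx), h0]; simp
  · rw [Multiset.count_eq_zero_of_notMem hx, h0]; simp

lemma pot_map (φ : ℕ → ℝ≥0∞) (s : Multiset (Pt d)) {f : Pt d → Pt d}
    (hf : Function.Injective f) : pot φ (s.map f) = pot φ s := by
  unfold pot
  have : (s.map f).toFinset = s.toFinset.image f := by
    ext x; simp
  rw [this, Finset.sum_image (fun a _ b _ h => hf h)]
  refine Finset.sum_congr rfl fun x _ => ?_
  rw [Multiset.count_map_eq_count' f s hf]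

lemma pot_sing (φ : ℕ → ℝ≥0∞) (x : Pt d) : pot φ {x} = φ 1 := by
  simp [pot]

lemma visT_append (a b : List (Pt d)) :
    visT (a ++ b) = visT a + (visT b).map (fun x => disp a + x) := by
  induction a with
  | nil => simp [visT, disp]
  | cons s a ih =>
    simp only [List.cons_append, visT, ih, Multiset.map_add, Multiset.map_map, Multiset.cons_add]
    congr 2
    refine Multiset.map_congr rfl fun x _ => ?_
    simp [disp, add_assoc]

lemma vis_append (a b : List (Pt d)) :
    vis (a ++ b) = vis a + (visT b).map (fun x => disp a + x) := by
  rw [vis, visT_append, vis, Multiset.cons_add]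

lemma visT_map (f : Pt d →+ Pt d) (a : List (Pt d)) : visT (a.map f) = (visT a).map f := by
  induction a with
  | nil => simp [visT]
  | cons s a ih =>
    simp only [List.map_cons, visT, ih, Multiset.map_cons, Multiset.map_map]
    congr 1
    refine Multiset.map_congr rfl fun x _ => ?_
    simp

lemma vis_map (f : Pt d →+ Pt d) (a : List (Pt d)) : vis (a.map f) = (vis a).map f := by
  simp [vis, visT_map]

lemma disp_map (f : Pt d →+ Pt d) (a : List (Pt d)) : disp (a.map f) = f (disp a) := by
  simp [disp, map_list_sum]

lemma vis_reverse (a : List (Pt d)) : vis a.reverse = (vis a).map (fun x => disp a - x) := by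
  induction a with
  | nil => simp [vis, visT, disp]
  | cons s a ih =>
    rw [List.reverse_cons, vis_append, ih, show vis (s :: a) = 0 ::ₘ visT (s :: a) from rfl,
      visT_cons s a, Multiset.map_cons,
      Multiset.map_map]
    have h2 : (visT [s]).map (fun x => disp a.reverse + x) = {disp (s::a) - 0} := by
      simp [visT, disp, add_comm]
    rw [h2, add_comm, Multiset.singleton_add]
    congr 1
    refine Multiset.map_congr rfl fun x _ => ?_
    simp [disp]

lemma PotE_map (φ : ℕ → ℝ≥0∞) (f : Pt d →+ Pt d) (hf : Function.Injective f) (a : List (Pt d)) :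
    PotE φ (a.map f) = PotE φ a := by
  rw [PotE_eq, PotE_eq, vis_map, pot_map φ _ hf]

lemma PotE_reverse (φ : ℕ → ℝ≥0∞) (a : List (Pt d)) :
    PotE φ a.reverse = PotE φ a := by
  rw [PotE_eq, PotE_eq, vis_reverse, pot_map φ _ (sub_right_injective)]

lemma PotE_visT {φ : ℕ → ℝ≥0∞} (h0 : φ 0 = 0) (a : List (Pt d)) (ha : (0 : Pt d) ∉ visT a) :
    PotE φ a = φ 1 + pot φ (visT a) := by
  rw [PotE_eq, vis, ← Multiset.singleton_add, pot_addD h0, pot_sing]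
  simpa using ha

lemma PotE_appendR {φ : ℕ → ℝ≥0∞} (h0 : φ 0 = 0) (hR : ∀ l m : ℕ, φ l + φ m ≤ φ (l + m))
    (a b : List (Pt d)) (hb : (0 : Pt d) ∉ visT b) :
    PotE φ a + PotE φ b ≤ PotE φ (a ++ b) + φ 1 := by
  rw [PotE_visT h0 b hb, PotE_eq, PotE_eq, vis_append]
  have := pot_addR h0 hR (vis a) ((visT b).map (fun x => disp a + x))
  rw [pot_map φ _ (add_right_injective _)] at this
  calc _ = pot φ (vis a) + pot φ (visT b) + φ 1 := by ring
    _ ≤ _ := by gcongr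

lemma PotE_appendA {φ : ℕ → ℝ≥0∞} (h0 : φ 0 = 0) (hm : Monotone φ)
    (hA : ∀ l m : ℕ, φ (l + m) ≤ φ l + φ m)
    (a b : List (Pt d)) :
    PotE φ (a ++ b) ≤ PotE φ a + PotE φ b := by
  rw [PotE_eq, PotE_eq, PotE_eq, vis_append]
  refine (pot_addA h0 hA _ _).trans ?_
  rw [pot_map φ _ (add_right_injective _)]
  gcongr
  exact pot_mono h0 hm (Multiset.le_cons_self _ _)

lemma PotE_appendD {φ : ℕ → ℝ≥0∞} (h0 : φ 0 = 0)
    (a b : List (Pt d)) (hb : (0 : Pt d) ∉ visT b)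
    (hab : ∀ x ∈ vis a, ∀ y ∈ visT b, x ≠ disp a + y) :
    PotE φ a + PotE φ b = PotE φ (a ++ b) + φ 1 := by
  rw [PotE_visT h0 b hb, PotE_eq, PotE_eq, vis_append, pot_addD h0,
    pot_map φ _ (add_right_injective _)]
  · ring
  · intro x hx h
    obtain ⟨y, hy, rfl⟩ := Multiset.mem_map.1 h
    exact hab _ hx y hy rfl

lemma PotE_append3 {φ : ℕ → ℝ≥0∞} (h0 : φ 0 = 0) (hR : ∀ l m : ℕ, φ l + φ m ≤ φ (l + m))
    (a b : List (Pt d)) :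
    PotE φ a + pot φ (visT b) ≤ PotE φ (a ++ b) := by
  rw [PotE_eq, PotE_eq, vis_append]
  have := pot_addR h0 hR (vis a) ((visT b).map (fun x => disp a + x))
  rwa [pot_map φ _ (add_right_injective _)] at this

lemma PotE_cons {φ : ℕ → ℝ≥0∞} (h0 : φ 0 = 0) (s : Pt d)
    (a : List (Pt d)) (hb : (0 : Pt d) ∉ visT (s :: a)) :
    PotE φ (s :: a) = φ 1 + PotE φ a := by
  rw [PotE_visT h0 _ hb, PotE_eq, visT_cons, pot_map φ _ (add_right_injective _)]

lemma split_last (p : Pt d → Prop) (γ : List (Pt d)) (hp : ∃ x ∈ vis γ, p x) :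
    ∃ a b, γ = a ++ b ∧ p (disp a) ∧ ∀ y ∈ visT b, ¬ p (disp a + y) := by
  induction γ generalizing p with
  | nil => exact ⟨[], [], rfl, by simpa [vis, visT, disp] using hp, by simp [visT]⟩
  | cons s γ ih =>
    by_cases h : ∃ x ∈ vis γ, p (s + x)
    · obtain ⟨a, b, hab, h1, h2⟩ := ih (fun x => p (s + x)) h
      refine ⟨s :: a, b, by simp [hab], by simpa [disp] using h1, ?_⟩
      intro y hy
      simpa [disp, add_assoc] using h2 y hy
    · refine ⟨[], s :: γ, rfl, ?_, ?_⟩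
      · obtain ⟨x, hx, hpx⟩ := hp
        rw [vis, Multiset.mem_cons] at hx
        rcases hx with rfl | hx
        · exact hpx
        · rw [visT_cons, Multiset.mem_map] at hx
          obtain ⟨y, hy, rfl⟩ := hx
          exact absurd ⟨y, hy, hpx⟩ h
      · intro y hy hpy
        rw [visT_cons, Multiset.mem_map] at hy
        obtain ⟨z, hz, rfl⟩ := hy
        exact h ⟨z, hz, by simpa [disp] using hpy⟩

lemma disp_append (a b : List (Pt d)) : disp (a ++ b) = disp a + disp b := by simp [disp]

lemma disp_mem_visT (s : Pt d) (a : List (Pt d)) : disp (s :: a) ∈ visT (s :: a) := by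
  induction a generalizing s with
  | nil => simp [visT, disp]
  | cons t a ih =>
    rw [visT]
    refine Multiset.mem_cons_of_mem (Multiset.mem_map.2 ⟨_, ih t, by simp [disp]⟩)

lemma disp_mem_vis (a : List (Pt d)) : disp a ∈ vis a := by
  cases a with
  | nil => simp [vis, disp]
  | cons s a => exact Multiset.mem_cons_of_mem (disp_mem_visT s a)

lemma expNegE_add (a b : ℝ≥0∞) : expNegE (a + b) = expNegE a * expNegE b := by
  unfold expNegE
  by_cases ha : a = ⊤
  · simp [ha]
  by_cases hb : b = ⊤
  · simp [hb]
  rw [if_neg ha, if_neg hb, if_neg (ENNReal.add_ne_top.2 ⟨ha, hb⟩), ENNReal.toReal_add ha hb,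
    ← ENNReal.ofReal_mul (Real.exp_pos _).le, ← Real.exp_add]
  congr 2; ring

lemma expNegE_anti {a b : ℝ≥0∞} (h : a ≤ b) : expNegE b ≤ expNegE a := by
  unfold expNegE
  by_cases hb : b = ⊤
  · simp [hb]
  have ha : a ≠ ⊤ := ne_top_of_le_ne_top hb h
  rw [if_neg ha, if_neg hb]
  apply ENNReal.ofReal_le_ofReal
  apply Real.exp_le_exp.2
  have := ENNReal.toReal_mono hb h
  linarith

lemma expNegE_le_one (a : ℝ≥0∞) : expNegE a ≤ 1 := by
  have := expNegE_anti (zero_le : 0 ≤ a)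
  simpa [expNegE] using this

lemma expNegE_ne_top (a : ℝ≥0∞) : expNegE a ≠ ⊤ :=
  ne_top_of_le_ne_top ENNReal.one_ne_top (expNegE_le_one a)

lemma expNegE_ne_zero {a : ℝ≥0∞} (h : a ≠ ⊤) : expNegE a ≠ 0 := by
  simp [expNegE, h, Real.exp_pos]

/-- generic tilt factor -/
def tilt (lam : ℝ) (g : Fin d → ℝ) (γ : List (Pt d)) : ℝ≥0∞ :=
  ENNReal.ofReal (Real.exp (-(lam * γ.length) + inr g (ctR (disp γ))))

/-- generic weight -/
def wt (φ : ℕ → ℝ≥0∞) (lam : ℝ) (g : Fin d → ℝ) (γ : List (Pt d)) : ℝ≥0∞ :=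
  expNegE (PotE φ γ) * tilt lam g γ

lemma inr_add (g : Fin d → ℝ) (x y : Pt d) :
    inr g (ctR (x + y)) = inr g (ctR x) + inr g (ctR y) := by
  simp [inr, ctR, mul_add, Finset.sum_add_distrib]

lemma tilt_append (lam : ℝ) (g : Fin d → ℝ) (a b : List (Pt d)) :
    tilt lam g (a ++ b) = tilt lam g a * tilt lam g b := by
  unfold tilt
  rw [← ENNReal.ofReal_mul (Real.exp_pos _).le, ← Real.exp_add, disp_append, inr_add]
  congr 2
  simp; ring

lemma wHE_eq (φ : ℕ → ℝ≥0∞) (g : Fin d → ℝ) (γ : List (Pt d)) : wHE φ g γ = wt φ 0 g γ := by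
  simp [wHE, wt, tilt]

lemma wE_eq (φ : ℕ → ℝ≥0∞) (lam : ℝ) (γ : List (Pt d)) : wE φ lam γ = wt φ lam 0 γ := by
  simp [wE, wt, tilt, inr]

lemma wt_split (φ : ℕ → ℝ≥0∞) (lam : ℝ) (g : Fin d → ℝ) (γ : List (Pt d)) :
    wt φ lam g γ = ENNReal.ofReal (Real.exp (-(lam * γ.length))) * wt φ 0 g γ := by
  unfold wt tilt
  rw [Real.exp_add, Real.exp_add, ENNReal.ofReal_mul (Real.exp_pos _).le,
    ENNReal.ofReal_mul (Real.exp_pos _).le]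
  simp
  ring

/-! generic summation lemmas -/

lemma G0 {α β : Type*} {u : α → ℝ≥0∞} {v : β → ℝ≥0∞} (f : α → β) (hf : Function.Injective f)
    (h : ∀ a, u a ≤ v (f a)) : ∑' a, u a ≤ ∑' b, v b :=
  (ENNReal.tsum_le_tsum h).trans (ENNReal.tsum_comp_le_tsum_of_injective hf v)

lemma G1 {α : Type*} {A X Y : Set α} (F : α → α → α) {f u v : α → ℝ≥0∞} (c : ℝ≥0∞)
    (h : ∀ γ ∈ A, ∃ x ∈ X, ∃ y ∈ Y, F x y = γ ∧ c * f γ ≤ u x * v y) :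
    c * ∑' γ : A, f γ ≤ (∑' x : X, u x) * ∑' y : Y, v y := by
  choose x hx y hy hF hc using h
  rw [← ENNReal.tsum_mul_left, ← ENNReal.tsum_mul_right]
  simp_rw [← ENNReal.tsum_mul_left]
  rw [← ENNReal.tsum_prod (f := fun (a : X) (b : Y) => u a * v b)]
  refine G0 (fun γ : A => ((⟨x γ γ.2, hx _ _⟩, ⟨y γ γ.2, hy _ _⟩) : X × Y)) ?_ ?_
  · intro a b hab
    simp only [Prod.mk.injEq, Subtype.mk.injEq] at hab
    apply Subtype.ext
    rw [← hF a a.2, ← hF b b.2, hab.1, hab.2]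
  · intro a
    exact hc a a.2

lemma G2 {α : Type*} {A X Y : Set α} (F : α → α → α) {f u v : α → ℝ≥0∞} (c : ℝ≥0∞)
    (h : ∀ x ∈ X, ∀ y ∈ Y, F x y ∈ A ∧ u x * v y ≤ c * f (F x y))
    (hinj : ∀ x ∈ X, ∀ y ∈ Y, ∀ x' ∈ X, ∀ y' ∈ Y, F x y = F x' y' → x = x' ∧ y = y') :
    (∑' x : X, u x) * ∑' y : Y, v y ≤ c * ∑' γ : A, f γ := by
  rw [← ENNReal.tsum_mul_left, ← ENNReal.tsum_mul_left]
  simp_rw [← ENNReal.tsum_mul_right]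
  rw [← ENNReal.tsum_prod (f := fun (b : Y) (a : X) => u a * v b)]
  refine G0 (fun p : Y × X => (⟨F p.2 p.1, (h _ p.2.2 _ p.1.2).1⟩ : A)) ?_ ?_
  · rintro ⟨⟨y, hy⟩, ⟨x, hx⟩⟩ ⟨⟨y', hy'⟩, ⟨x', hx'⟩⟩ hab
    simp only [Subtype.mk.injEq] at hab
    obtain ⟨rfl, rfl⟩ := hinj x hx y hy x' hx' y' hy' hab
    rfl
  · rintro ⟨⟨y, hy⟩, ⟨x, hx⟩⟩
    exact (h x hx y hy).2

lemma G3 {ι : Type*} {α : Type*} (A : ι → Set α) (C : ℕ → Set α) (len : α → ℕ) (w : α → ℝ≥0∞)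
    (hA : ∀ i j γ, γ ∈ A i → γ ∈ A j → i = j) (hC : ∀ i, ∀ γ ∈ A i, γ ∈ C (len γ)) :
    ∑' i, ∑' γ : A i, w γ ≤ ∑' n, ∑' γ : C n, w γ := by
  rw [← ENNReal.tsum_sigma (fun i (γ : A i) => w γ), ← ENNReal.tsum_sigma (fun i (γ : C i) => w γ)]
  refine G0 (fun p : (Σ i, A i) => (⟨len p.2, ⟨p.2, hC _ _ p.2.2⟩⟩ : Σ n, C n)) ?_ ?_
  · rintro ⟨i, γ, hi⟩ ⟨j, γ', hj⟩ hab
    have h2 : γ = γ' := by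
      have := congrArg (fun p : (Σ n, C n) => (p.2 : α)) hab
      simpa using this
    subst h2
    obtain rfl := hA i j γ hi hj
    rfl
  · intro a
    exact le_rfl

end Aux

section Aux2
variable {d : ℕ}

/-- strict half-space paths of span at most `k` -/
def SHk (L : Pt d →+ ℤ) (k : ℕ) : Set (List (Pt d)) :=
  {γ | IsPath γ ∧ ∀ x ∈ visT γ, 0 < L x ∧ L x ≤ k}

/-- bridges of span `k` -/
def Br (L : Pt d →+ ℤ) (k : ℕ) : Set (List (Pt d)) :=
  {γ | IsPath γ ∧ (∀ x ∈ visT γ, 0 < L x ∧ L x ≤ k) ∧ L (disp γ) = k}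

lemma zero_notMem_visT (L : Pt d →+ ℤ) {γ : List (Pt d)} (h : ∀ x ∈ visT γ, 0 < L x) :
    (0 : Pt d) ∉ visT γ := by
  intro h0
  have := h 0 h0
  simp at this

lemma IsPath_append {a b : List (Pt d)} : IsPath (a ++ b) ↔ IsPath a ∧ IsPath b := by
  unfold IsPath
  constructor
  · intro h
    exact ⟨fun s hs => h s (by simp [hs]), fun s hs => h s (by simp [hs])⟩
  · rintro ⟨h1, h2⟩ s hs
    rcases List.mem_append.1 hs with h | h
    · exact h1 s h
    · exact h2 s h

lemma IsStep_neg {s : Pt d} (h : IsStep s) : IsStep (-s) := by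
  unfold IsStep at *
  simpa using h

lemma IsPath_map {f : Pt d → Pt d} (hf : ∀ s, IsStep s → IsStep (f s)) {a : List (Pt d)}
    (ha : IsPath a) : IsPath (a.map f) := by
  intro s hs
  obtain ⟨t, ht, rfl⟩ := List.mem_map.1 hs
  exact hf t (ha t ht)

lemma IsPath_reverse {a : List (Pt d)} (ha : IsPath a) : IsPath a.reverse := by
  intro s hs
  exact ha s (by simpa using hs)

lemma tilt_zero (lam : ℝ) (γ : List (Pt d)) :
    tilt lam 0 γ = ENNReal.ofReal (Real.exp (-(lam * γ.length))) := by
  simp [tilt, inr]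

/-- negation as a homomorphism -/
def ng : Pt d →+ Pt d := negAddMonoidHom

@[simp] lemma ng_apply (x : Pt d) : ng x = -x := rfl

lemma ng_inj : Function.Injective (ng : Pt d → Pt d) := fun a b h => by simpa using h

lemma map_ng_ng (a : List (Pt d)) : (a.map ng).map ng = a := by
  simp [List.map_map, Function.comp_def]

lemma wt_ng (φ : ℕ → ℝ≥0∞) (lam : ℝ) (a : List (Pt d)) : wt φ lam 0 (a.map ng) = wt φ lam 0 a := by
  unfold wt
  rw [PotE_map φ ng ng_inj, tilt_zero, tilt_zero, List.length_map]

lemma wt_reverse (φ : ℕ → ℝ≥0∞) (lam : ℝ) (a : List (Pt d)) :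
    wt φ lam 0 a.reverse = wt φ lam 0 a := by
  unfold wt
  rw [PotE_reverse φ, tilt_zero, tilt_zero, List.length_reverse]

lemma wt_appendR {φ : ℕ → ℝ≥0∞} (h0 : φ 0 = 0) (hR : ∀ l m : ℕ, φ l + φ m ≤ φ (l + m))
    (lam : ℝ) (g : Fin d → ℝ) (a b : List (Pt d)) (hb : (0 : Pt d) ∉ visT b) :
    expNegE (φ 1) * wt φ lam g (a ++ b) ≤ wt φ lam g a * wt φ lam g b := by
  unfold wt
  rw [tilt_append]
  have h1 := expNegE_anti (PotE_appendR h0 hR a b hb)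
  rw [expNegE_add, expNegE_add] at h1
  calc _ = (expNegE (PotE φ (a ++ b)) * expNegE (φ 1)) * (tilt lam g a * tilt lam g b) := by ring
    _ ≤ (expNegE (PotE φ a) * expNegE (PotE φ b)) * (tilt lam g a * tilt lam g b) := by gcongr
    _ = _ := by ring

lemma mem_vis_iff {γ : List (Pt d)} {x : Pt d} : x ∈ vis γ ↔ x = 0 ∨ x ∈ visT γ := by
  simp [vis]

lemma hw_step {φ : ℕ → ℝ≥0∞} (h0 : φ 0 = 0) (hR : ∀ l m : ℕ, φ l + φ m ≤ φ (l + m))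
    (L : Pt d →+ ℤ) (lam : ℝ) (k : ℕ) :
    expNegE (φ 1) * ∑' γ : SHk L (k+1), wt φ lam 0 γ.1 ≤
      expNegE (φ 1) * (∑' γ : SHk L k, wt φ lam 0 γ.1) +
        (∑' γ : Br L (k+1), wt φ lam 0 γ.1) * ∑' γ : SHk L k, wt φ lam 0 γ.1 := by
  have hsub : SHk L (k+1) ⊆ SHk L k ∪ (SHk L (k+1) \ SHk L k) := by
    intro x hx
    by_cases h : x ∈ SHk L k
    · exact Or.inl h
    · exact Or.inr ⟨hx, h⟩
  have h1 : ∑' γ : SHk L (k+1), wt φ lam 0 γ.1 ≤ (∑' γ : SHk L k, wt φ lam 0 γ.1) +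
      ∑' γ : (SHk L (k+1) \ SHk L k : Set _), wt φ lam 0 γ.1 :=
    (ENNReal.tsum_mono_subtype _ hsub).trans (ENNReal.tsum_union_le _ _ _)
  have h2 : expNegE (φ 1) * ∑' γ : (SHk L (k+1) \ SHk L k : Set _), wt φ lam 0 γ.1 ≤
      (∑' γ : Br L (k+1), wt φ lam 0 γ.1) * ∑' γ : SHk L k, wt φ lam 0 γ.1 := by
    refine G1 (fun x y => x ++ y.map ng) _ ?_
    rintro γ ⟨⟨hγp, hγ⟩, hn⟩
    have hex : ∃ x ∈ vis γ, L x = k + 1 := by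
      by_contra hcon
      push Not at hcon
      refine hn ⟨hγp, fun x hx => ⟨(hγ x hx).1, ?_⟩⟩
      have := hcon x (mem_vis_iff.2 (Or.inr hx))
      have h3 := (hγ x hx).2
      push_cast at h3
      omega
    obtain ⟨a, b, rfl, hp, hb⟩ := split_last (fun x => L x = k + 1) γ hex
    rw [IsPath_append] at hγp
    have hma : ∀ x ∈ visT a, x ∈ visT (a ++ b) := by
      intro x hx
      rw [visT_append]
      exact Multiset.mem_add.2 (Or.inl hx)
    have hmb : ∀ x ∈ visT b, disp a + x ∈ visT (a ++ b) := by
      intro x hx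
      rw [visT_append]
      exact Multiset.mem_add.2 (Or.inr (Multiset.mem_map_of_mem _ hx))
    have hbn : ∀ x ∈ visT (b.map ng), 0 < L x ∧ L x ≤ k := by
      intro x hx
      rw [visT_map, Multiset.mem_map] at hx
      obtain ⟨y, hy, rfl⟩ := hx
      have h3 := hγ _ (hmb y hy)
      have h4 := hb y hy
      rw [map_add, hp] at h3 h4
      push_cast at h3
      rw [ng_apply, map_neg]
      constructor <;> omega
    refine ⟨a, ⟨hγp.1, fun x hx => hγ x (hma x hx), by rw [hp]; push_cast; rfl⟩, b.map ng,
      ⟨IsPath_map (fun s hs => IsStep_neg hs) hγp.2, hbn⟩, by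
        show a ++ (b.map ng).map ng = a ++ b
        rw [map_ng_ng], ?_⟩
    rw [wt_ng]
    refine wt_appendR h0 hR lam 0 a b ?_
    intro hz
    apply zero_notMem_visT L (fun x hx => (hbn x hx).1)
    rw [visT_map, Multiset.mem_map]
    exact ⟨0, hz, by simp⟩
  calc _ ≤ expNegE (φ 1) * ((∑' γ : SHk L k, wt φ lam 0 γ.1) +
      ∑' γ : (SHk L (k+1) \ SHk L k : Set _), wt φ lam 0 γ.1) := by gcongr
    _ ≤ _ := by rw [mul_add]; gcongr

lemma wt_le_tilt (φ : ℕ → ℝ≥0∞) (lam : ℝ) (g : Fin d → ℝ) (γ : List (Pt d)) :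
    wt φ lam g γ ≤ tilt lam g γ := by
  unfold wt
  calc _ ≤ 1 * tilt lam g γ := by gcongr; exact expNegE_le_one _
    _ = _ := one_mul _

lemma SH_zero (φ : ℕ → ℝ≥0∞) (L : Pt d →+ ℤ) (lam : ℝ) :
    ∑' γ : SHk L 0, wt φ lam 0 γ.1 ≤ 1 := by
  have hs : SHk L 0 ⊆ {[]} := by
    rintro γ ⟨_, h⟩
    cases γ with
    | nil => rfl
    | cons s γ =>
      have := h s (by simp [visT])
      push_cast at this
      omega
  refine (ENNReal.tsum_mono_subtype _ hs).trans ?_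
  rw [tsum_singleton]
  refine (wt_le_tilt _ _ _ _).trans ?_
  simp [tilt_zero]

lemma hw_bound {φ : ℕ → ℝ≥0∞} (h0 : φ 0 = 0) (h1 : φ 1 ≠ ⊤)
    (hR : ∀ l m : ℕ, φ l + φ m ≤ φ (l + m))
    (L : Pt d →+ ℤ) (lam a : ℝ) (ha : 0 < a)
    (hB : ∀ k : ℕ, ∑' γ : Br L (k+1), wt φ lam 0 γ.1 ≤
      expNegE (φ 1) * ENNReal.ofReal (Real.exp (-(a * (k+1))))) (N : ℕ) :
    ∑' γ : SHk L N, wt φ lam 0 γ.1 ≤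
      ENNReal.ofReal (Real.exp (∑' k : ℕ, Real.exp (-(a * (k+1))))) := by
  have hsum : Summable (fun k : ℕ => Real.exp (-(a * (k+1)))) := by
    have : (fun k : ℕ => Real.exp (-(a * (k+1)))) = fun k : ℕ => Real.exp (-a) * Real.exp (-a) ^ k := by
      funext k
      rw [← Real.exp_nat_mul, ← Real.exp_add]
      congr 1; ring
    rw [this]
    exact (summable_geometric_of_lt_one (Real.exp_pos _).le (by simpa using ha)).mul_left _
  have hq0 := expNegE_ne_zero h1
  have hqt := expNegE_ne_top (φ 1)
  have key : ∀ N : ℕ, ∑' γ : SHk L N, wt φ lam 0 γ.1 ≤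
      ENNReal.ofReal (Real.exp (∑ k ∈ Finset.range N, Real.exp (-(a * (k+1))))) := by
    intro N
    induction N with
    | zero => simpa using SH_zero φ L lam
    | succ N ih =>
      have h := hw_step h0 hR L lam N
      have h2 : expNegE (φ 1) * ∑' γ : SHk L (N+1), wt φ lam 0 γ.1 ≤ expNegE (φ 1) *
          ((1 + ENNReal.ofReal (Real.exp (-(a * (N+1))))) * ∑' γ : SHk L N, wt φ lam 0 γ.1) := by
        refine h.trans ?_
        calc _ ≤ expNegE (φ 1) * (∑' γ : SHk L N, wt φ lam 0 γ.1) +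
          (expNegE (φ 1) * ENNReal.ofReal (Real.exp (-(a * (N+1))))) * ∑' γ : SHk L N, wt φ lam 0 γ.1 := by
              gcongr; exact hB N
          _ = _ := by ring
      rw [ENNReal.mul_le_mul_iff_right hq0 hqt] at h2
      refine h2.trans ?_
      rw [Finset.sum_range_succ, Real.exp_add, ENNReal.ofReal_mul (Real.exp_pos _).le, mul_comm]
      gcongr
      rw [← ENNReal.ofReal_one, ← ENNReal.ofReal_add zero_le_one (Real.exp_pos _).le]
      apply ENNReal.ofReal_le_ofReal
      have := Real.add_one_le_exp (Real.exp (-(a * (N+1))))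
      linarith
  refine (key N).trans (ENNReal.ofReal_le_ofReal (Real.exp_le_exp.2 ?_))
  exact hsum.sum_le_tsum _ (fun _ _ => (Real.exp_pos _).le)

lemma L_le_length (L : Pt d →+ ℤ) (hL : ∀ s, IsStep s → |L s| ≤ 1) (γ : List (Pt d))
    (hγ : IsPath γ) : ∀ x ∈ vis γ, L x ≤ γ.length := by
  induction γ with
  | nil => intro x hx; simp [vis, visT] at hx; simp [hx]
  | cons s γ ih =>
    intro x hx
    rw [mem_vis_iff] at hx
    rcases hx with rfl | hx
    · simp; positivity
    · rw [visT_cons, Multiset.mem_map] at hx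
      obtain ⟨y, hy, rfl⟩ := hx
      have h1 := ih (fun t ht => hγ t (by simp [ht])) y hy
      have h2 := (abs_le.1 (hL s (hγ s (by simp)))).2
      rw [map_add, List.length_cons]
      push_cast
      omega

lemma wt_cons {φ : ℕ → ℝ≥0∞} (h0 : φ 0 = 0) (lam : ℝ) (s : Pt d)
    (a : List (Pt d)) (hb : (0 : Pt d) ∉ visT (s :: a)) :
    wt φ lam 0 (s :: a) = expNegE (φ 1) * ENNReal.ofReal (Real.exp (-lam)) * wt φ lam 0 a := by
  unfold wt
  rw [PotE_cons h0 s a hb, expNegE_add, show s :: a = [s] ++ a from rfl, tilt_append, tilt_zero lam [s]]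
  simp
  ring

lemma hw_general {φ : ℕ → ℝ≥0∞} (h0 : φ 0 = 0) 
    (hR : ∀ l m : ℕ, φ l + φ m ≤ φ (l + m))
    (L : Pt d →+ ℤ) (hL : ∀ s, IsStep s → |L s| ≤ 1) (e : Pt d) (he : IsStep e) (hLe : L e = 1)
    (lam : ℝ) (N : ℕ) :
    (expNegE (φ 1) ^ 2 * ENNReal.ofReal (Real.exp (-lam))) *
      ∑' γ : {γ : List (Pt d) | IsPath γ ∧ γ.length < N}, wt φ lam 0 γ.1 ≤
     (∑' γ : SHk L N, wt φ lam 0 γ.1) * ∑' γ : SHk L N, wt φ lam 0 γ.1 := by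
  refine G1 (fun x y => (x.tail.map ng).reverse ++ y) _ ?_
  rintro γ ⟨hγp, hlen⟩
  obtain ⟨x0, hx0, hmin⟩ := (vis γ).toFinset.exists_min_image L ⟨0, by simp [vis]⟩
  simp only [Multiset.mem_toFinset] at hx0 hmin
  obtain ⟨a, b, rfl, hp, hb⟩ := split_last (fun x => L x = L x0) γ ⟨x0, hx0, rfl⟩
  rw [IsPath_append] at hγp
  rw [List.length_append] at hlen
  have hma : ∀ x ∈ vis a, L x0 ≤ L x := by
    intro x hx
    apply hmin
    rw [vis_append]
    exact Multiset.mem_add.2 (Or.inl hx)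
  have hmb : ∀ x ∈ visT b, 0 < L x := by
    intro x hx
    have h3 := hmin (disp a + x) (by
      rw [vis_append]
      exact Multiset.mem_add.2 (Or.inr (Multiset.mem_map_of_mem _ hx)))
    have h4 := hb x hx
    rw [map_add, hp] at h3 h4
    omega
  have hra : IsPath (a.reverse.map ng) :=
    IsPath_map (fun s hs => IsStep_neg hs) (IsPath_reverse hγp.1)
  have hrv : ∀ x ∈ vis (a.reverse.map ng), 0 ≤ L x := by
    intro x hx
    rw [vis_map, vis_reverse, Multiset.mem_map] at hx
    obtain ⟨y, hy, rfl⟩ := hx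
    rw [Multiset.mem_map] at hy
    obtain ⟨z, hz, rfl⟩ := hy
    rw [ng_apply, map_neg, map_sub, hp]
    have := hma z hz
    omega
  have hcp : ∀ x ∈ visT (e :: a.reverse.map ng), 0 < L x := by
    intro x hx
    rw [visT_cons, Multiset.mem_map] at hx
    obtain ⟨y, hy, rfl⟩ := hx
    rw [map_add, hLe]
    have := hrv y hy
    omega
  have hcpath : IsPath (e :: a.reverse.map ng) := by
    intro s hs
    rcases List.mem_cons.1 hs with rfl | h
    · exact he
    · exact hra s h
  refine ⟨e :: a.reverse.map ng, ⟨hcpath, fun x hx => ⟨hcp x hx, ?_⟩⟩, b,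
    ⟨hγp.2, fun x hx => ⟨hmb x hx, ?_⟩⟩, ?_, ?_⟩
  · have := L_le_length L hL _ hcpath x (mem_vis_iff.2 (Or.inr hx))
    simp at this
    omega
  · have := L_le_length L hL _ hγp.2 x (mem_vis_iff.2 (Or.inr hx))
    omega
  · show (((a.reverse.map ng)).map ng).reverse ++ b = a ++ b
    rw [map_ng_ng, List.reverse_reverse]
  · rw [wt_cons h0 lam e _ (zero_notMem_visT L hcp), wt_ng, wt_reverse]
    have := wt_appendR h0 hR lam 0 a b (zero_notMem_visT L hmb)
    calc _ = (expNegE (φ 1) * ENNReal.ofReal (Real.exp (-lam))) *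
        (expNegE (φ 1) * wt φ lam 0 (a ++ b)) := by ring
      _ ≤ (expNegE (φ 1) * ENNReal.ofReal (Real.exp (-lam))) * (wt φ lam 0 a * wt φ lam 0 b) := by
        gcongr
      _ = _ := by ring

lemma wt_bridge {φ : ℕ → ℝ≥0∞} (h0 : φ 0 = 0) (L : Pt d →+ ℤ) (lam : ℝ) (g : Fin d → ℝ)
    {j k : ℕ} {a b : List (Pt d)} (ha : a ∈ Br L j) (hb : b ∈ Br L k) :
    wt φ lam g a * wt φ lam g b = expNegE (φ 1) * wt φ lam g (a ++ b) := by
  unfold wt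
  rw [tilt_append]
  have hz := zero_notMem_visT L (fun x hx => (hb.2.1 x hx).1)
  have h1 := PotE_appendD h0 a b hz (by
    intro x hx y hy hxy
    have h2 := (hb.2.1 y hy).1
    have h3 : L x ≤ j := by
      rcases mem_vis_iff.1 hx with rfl | h
      · simp
      · exact (ha.2.1 x h).2
    rw [hxy, map_add, ha.2.2] at h3
    omega)
  have h2 := congrArg expNegE h1
  rw [expNegE_add, expNegE_add] at h2
  calc _ = (expNegE (PotE φ a) * expNegE (PotE φ b)) * (tilt lam g a * tilt lam g b) := by ring
    _ = _ := by rw [h2]; ring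

lemma Br_append (L : Pt d →+ ℤ) {j k : ℕ} {a b : List (Pt d)} (ha : a ∈ Br L j)
    (hb : b ∈ Br L k) : a ++ b ∈ Br L (j + k) := by
  refine ⟨IsPath_append.2 ⟨ha.1, hb.1⟩, ?_, ?_⟩
  · intro x hx
    rw [visT_append, Multiset.mem_add] at hx
    push_cast
    rcases hx with hx | hx
    · have := ha.2.1 x hx
      omega
    · obtain ⟨y, hy, rfl⟩ := Multiset.mem_map.1 hx
      have := hb.2.1 y hy
      rw [map_add, ha.2.2]
      omega
  · rw [disp_append, map_add, ha.2.2, hb.2.2]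
    push_cast; rfl

lemma Br_inj (L : Pt d →+ ℤ) {j k : ℕ} {a b a' b' : List (Pt d)} (ha : a ∈ Br L j)
    (hb : b ∈ Br L k) (ha' : a' ∈ Br L j) (hb' : b' ∈ Br L k) (h : a ++ b = a' ++ b') :
    a = a' ∧ b = b' := by
  have aux : ∀ {a b a' b' : List (Pt d)} (c : List (Pt d)), a ∈ Br L j → b ∈ Br L k → a' ∈ Br L j →
      b' ∈ Br L k → a' = a ++ c → b = c ++ b' → c = [] := by
    intro a b a' b' c ha hb ha' hb' h1 h2
    cases c with
    | nil => rfl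
    | cons s c =>
      exfalso
      have h3 : disp (s :: c) ∈ visT b := by
        rw [h2, visT_append]
        exact Multiset.mem_add.2 (Or.inl (disp_mem_visT s c))
      have h4 := (hb.2.1 _ h3).1
      have h5 := ha'.2.2
      rw [h1, disp_append, map_add, ha.2.2] at h5
      omega
  rcases List.append_eq_append_iff.1 h with ⟨c, h1, h2⟩ | ⟨c, h1, h2⟩
  · obtain rfl := aux c ha hb ha' hb' h1 h2
    simp at h1 h2
    exact ⟨h1.symm, h2⟩
  · obtain rfl := aux c ha' hb' ha hb h1 h2
    simp at h1 h2
    exact ⟨h1, h2.symm⟩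

lemma B_super {φ : ℕ → ℝ≥0∞} (h0 : φ 0 = 0) (L : Pt d →+ ℤ) (lam : ℝ) (g : Fin d → ℝ)
    (j k : ℕ) :
    (∑' γ : Br L j, wt φ lam g γ.1) * (∑' γ : Br L k, wt φ lam g γ.1) ≤
      expNegE (φ 1) * ∑' γ : Br L (j + k), wt φ lam g γ.1 := by
  refine G2 (fun x y => x ++ y) _ ?_ ?_
  · intro x hx y hy
    exact ⟨Br_append L hx hy, (wt_bridge h0 L lam g hx hy).le⟩
  · intro x hx y hy x' hx' y' hy' h
    exact Br_inj L hx hy hx' hy' h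

/-- bridges of length `n` -/
def BrN (L : Pt d →+ ℤ) (n : ℕ) : Set (List (Pt d)) := {γ | γ.length = n ∧ ∃ k, γ ∈ Br L k}

lemma b_super {φ : ℕ → ℝ≥0∞} (h0 : φ 0 = 0) (L : Pt d →+ ℤ) (lam : ℝ) (g : Fin d → ℝ)
    (n m : ℕ) :
    (∑' γ : BrN L n, wt φ lam g γ.1) * (∑' γ : BrN L m, wt φ lam g γ.1) ≤
      expNegE (φ 1) * ∑' γ : BrN L (n + m), wt φ lam g γ.1 := by
  refine G2 (fun x y => x ++ y) _ ?_ ?_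
  · rintro x ⟨hx, k, hk⟩ y ⟨hy, j, hj⟩
    exact ⟨⟨by simp [hx, hy], k + j, Br_append L hk hj⟩, (wt_bridge h0 L lam g hk hj).le⟩
  · intro x hx y hy x' hx' y' hy' h
    exact List.append_inj h (hx.1.trans hx'.1.symm)

/-- If every fixed-length bridge sum is small, every fixed-span bridge sum is small. -/
lemma B_small {φ : ℕ → ℝ≥0∞} (h0 : φ 0 = 0) (h1 : φ 1 ≠ ⊤) (L : Pt d →+ ℤ) (lam lam0 : ℝ)
    (hlam : lam0 < lam) (g : Fin d → ℝ)
    (hb : ∀ n : ℕ, ∑' γ : BrN L n, wt φ 0 g γ.1 ≤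
      expNegE (φ 1) * ENNReal.ofReal (Real.exp (lam0 * n))) (k : ℕ) :
    ∑' γ : Br L (k+1), wt φ lam g γ.1 ≤ expNegE (φ 1) := by
  by_contra hcon
  push Not at hcon
  have hq0 := expNegE_ne_zero h1
  have hqt := expNegE_ne_top (φ 1)
  have hm : ∀ m : ℕ, expNegE (φ 1) ≤ ∑' γ : Br L ((m+1)*(k+1)), wt φ lam g γ.1 := by
    intro m
    induction m with
    | zero => rw [zero_add, one_mul]; exact hcon.le
    | succ m ih =>
      have h := B_super h0 L lam g ((m+1)*(k+1)) (k+1)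
      rw [show (m+1)*(k+1) + (k+1) = (m+1+1)*(k+1) by ring] at h
      have h2 := (mul_le_mul' ih hcon.le).trans h
      rwa [ENNReal.mul_le_mul_iff_right hq0 hqt] at h2
  have hinf : ∑' m : ℕ, ∑' γ : Br L ((m+1)*(k+1)), wt φ lam g γ.1 = ⊤ := by
    rw [eq_top_iff]
    calc (⊤ : ℝ≥0∞) = ∑' _ : ℕ, expNegE (φ 1) := (ENNReal.tsum_const_eq_top_of_ne_zero hq0).symm
      _ ≤ _ := ENNReal.tsum_le_tsum hm
  have h3 := G3 (fun m : ℕ => Br L ((m+1)*(k+1))) (BrN L) List.length (wt φ lam g) (by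
      intro i j γ hi hj
      have h4 := hi.2.2.symm.trans hj.2.2
      have h5 : (i+1)*(k+1) = (j+1)*(k+1) := by exact_mod_cast h4
      have := Nat.eq_of_mul_eq_mul_right (Nat.succ_pos k) h5
      omega) (fun i γ hγ => ⟨rfl, _, hγ⟩)
  rw [hinf, top_le_iff] at h3
  have h4 : ∑' n : ℕ, ∑' γ : BrN L n, wt φ lam g γ.1 ≤
      ∑' n : ℕ, expNegE (φ 1) * ENNReal.ofReal (Real.exp (-(lam - lam0)) ^ n) := by
    refine ENNReal.tsum_le_tsum fun n => ?_
    have : ∑' γ : BrN L n, wt φ lam g γ.1 =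
        ENNReal.ofReal (Real.exp (-(lam * n))) * ∑' γ : BrN L n, wt φ 0 g γ.1 := by
      rw [← ENNReal.tsum_mul_left]
      refine tsum_congr fun γ => ?_
      rw [wt_split, γ.2.1]
    rw [this]
    calc _ ≤ ENNReal.ofReal (Real.exp (-(lam * n))) *
          (expNegE (φ 1) * ENNReal.ofReal (Real.exp (lam0 * n))) := by gcongr; exact hb n
      _ = expNegE (φ 1) * (ENNReal.ofReal (Real.exp (-(lam * n))) * ENNReal.ofReal (Real.exp (lam0 * n))) := by ring
      _ = _ := by
        rw [← ENNReal.ofReal_mul (Real.exp_pos _).le, ← Real.exp_add, ← Real.exp_nat_mul]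
        congr 3; ring
  rw [h3, top_le_iff, ENNReal.tsum_mul_left, ← ENNReal.ofReal_tsum_of_nonneg
    (fun n => by positivity) (summable_geometric_of_lt_one (Real.exp_pos _).le (by simpa using hlam))] at h4
  exact ENNReal.mul_ne_top hqt ENNReal.ofReal_ne_top h4

/-- reflection symmetrisation -/
lemma B_tilt (φ : ℕ → ℝ≥0∞) (L : Pt d →+ ℤ) (lam a : ℝ) (g : Fin d → ℝ)
    (ρ : Pt d →+ Pt d) (hρ : ∀ x, ρ (ρ x) = x) (hρs : ∀ s, IsStep s → IsStep (ρ s))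
    (hρL : ∀ x, L (ρ x) = L x)
    (hg : ∀ x : Pt d, inr g (ctR x) + inr g (ctR (ρ x)) = 2 * (a * (L x : ℝ))) (k : ℕ) :
    ENNReal.ofReal (Real.exp (a * k)) * ∑' γ : Br L k, wt φ lam 0 γ.1 ≤
      ∑' γ : Br L k, wt φ lam g γ.1 := by
  have hρi : Function.Injective ρ := fun x y h => by rw [← hρ x, h, hρ]
  have hmem : ∀ γ ∈ Br L k, γ.map ρ ∈ Br L k := by
    rintro γ ⟨h1, h2, h3⟩
    refine ⟨IsPath_map hρs h1, ?_, ?_⟩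
    · intro x hx
      rw [visT_map, Multiset.mem_map] at hx
      obtain ⟨y, hy, rfl⟩ := hx
      rw [hρL]
      exact h2 y hy
    · rw [disp_map, hρL, h3]
  have hsw : ∑' γ : Br L k, wt φ lam g (γ.1.map ρ) ≤ ∑' γ : Br L k, wt φ lam g γ.1 := by
    refine G0 (fun γ : Br L k => (⟨γ.1.map ρ, hmem _ γ.2⟩ : Br L k)) ?_ (fun _ => le_rfl)
    intro x y h
    simp only [Subtype.mk.injEq] at h
    exact Subtype.ext (List.map_injective_iff.2 hρi h)
  have h2 : 2 * (ENNReal.ofReal (Real.exp (a * k)) * ∑' γ : Br L k, wt φ lam 0 γ.1) ≤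
      ∑' γ : Br L k, wt φ lam g γ.1 + ∑' γ : Br L k, wt φ lam g (γ.1.map ρ) := by
    rw [← ENNReal.tsum_add, ← ENNReal.tsum_mul_left, ← ENNReal.tsum_mul_left]
    refine ENNReal.tsum_le_tsum fun γ => ?_
    unfold wt
    rw [PotE_map φ ρ hρi, ← mul_add]
    rw [show 2 * (ENNReal.ofReal (Real.exp (a * k)) * (expNegE (PotE φ γ.1) * tilt lam 0 γ.1)) =
      expNegE (PotE φ γ.1) * (2 * (ENNReal.ofReal (Real.exp (a * k)) * tilt lam 0 γ.1)) by ring]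
    gcongr
    unfold tilt
    have hD := hg (disp γ.1)
    rw [γ.2.2.2] at hD
    push_cast at hD
    rw [disp_map, List.length_map, ← ENNReal.ofReal_mul (Real.exp_pos _).le, ← ENNReal.ofReal_add
      (Real.exp_pos _).le (Real.exp_pos _).le, show (2:ℝ≥0∞) = ENNReal.ofReal 2 by simp,
      ← ENNReal.ofReal_mul (by norm_num)]
    apply ENNReal.ofReal_le_ofReal
    set X := inr g (ctR (disp γ.1))
    set Y := inr g (ctR (ρ (disp γ.1)))
    have e0 : inr (0 : Fin d → ℝ) (ctR (disp γ.1)) = 0 := by simp [inr]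
    rw [e0, add_zero, Real.exp_add, Real.exp_add, mul_comm (Real.exp (a*k)), ← mul_assoc,
      mul_comm 2, mul_assoc, ← mul_add]
    refine mul_le_mul_of_nonneg_left ?_ (Real.exp_pos _).le
    have hX : Real.exp X = Real.exp (a * k) * Real.exp ((X - Y) / 2) := by
      rw [← Real.exp_add]; congr 1; linarith
    have hY : Real.exp Y = Real.exp (a * k) * Real.exp (-((X - Y) / 2)) := by
      rw [← Real.exp_add]; congr 1; linarith
    rw [hX, hY, ← mul_add]
    have := Real.one_le_cosh ((X-Y)/2)
    rw [Real.cosh_eq] at this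
    nlinarith [Real.exp_pos (a * k)]
  have h3 := h2.trans (add_le_add_right hsw _)
  rw [← two_mul, ENNReal.mul_le_mul_iff_right (by norm_num) (by norm_num)] at h3
  exact h3

end Aux2

section Aux3
variable {d : ℕ}

lemma steps_finite (d : ℕ) : {s : Pt d | IsStep s}.Finite := by
  refine Set.Finite.subset (Set.finite_Icc (fun _ => (-1 : ℤ)) (fun _ => 1)) ?_
  intro s hs
  have h : ∀ i, |s i| ≤ 1 := by
    intro i
    have h2 : (∑ i, |s i|) = 1 := hs
    rw [← h2]
    exact Finset.single_le_sum (f := fun i => |s i|) (fun _ _ => abs_nonneg _) (Finset.mem_univ i)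
  exact ⟨fun i => (abs_le.1 (h i)).1, fun i => (abs_le.1 (h i)).2⟩

lemma PathsN_finite (d n : ℕ) : (PathsN d n).Finite := by
  have : Finite {s : Pt d | IsStep s} := (steps_finite d).to_subtype
  have hf := (List.finite_length_eq {s : Pt d | IsStep s} n).image (List.map Subtype.val)
  refine hf.subset ?_
  rintro γ ⟨hγ, hn⟩
  refine ⟨γ.attach.map (fun s => ⟨s.1, hγ s.1 s.2⟩), ?_, ?_⟩
  · show List.length _ = n
    simpa using hn
  simp [List.map_map, Function.comp_def]

lemma wt_ne_top (φ : ℕ → ℝ≥0∞) (lam : ℝ) (g : Fin d → ℝ) (γ : List (Pt d)) :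
    wt φ lam g γ ≠ ⊤ := ENNReal.mul_ne_top (expNegE_ne_top _) ENNReal.ofReal_ne_top

lemma tsum_PathsN_ne_top (n : ℕ) (f : List (Pt d) → ℝ≥0∞) (hf : ∀ γ, f γ ≠ ⊤) :
    ∑' γ : PathsN d n, f γ ≠ ⊤ := by
  have := (PathsN_finite d n).fintype
  rw [tsum_fintype]
  exact ENNReal.sum_ne_top.2 fun γ _ => hf _

lemma ZE_eq (φ : ℕ → ℝ≥0∞) (n : ℕ) : ZE d φ n = ∑' γ : PathsN d n, wt φ 0 0 γ.1 := by
  unfold ZE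
  refine tsum_congr fun γ => ?_
  simp [wt, tilt_zero]

lemma ZHE_eq (φ : ℕ → ℝ≥0∞) (h : Fin d → ℝ) (n : ℕ) :
    ZHE d φ h n = ∑' γ : PathsN d n, wt φ 0 h γ.1 := by
  unfold ZHE
  exact tsum_congr fun γ => wHE_eq _ _ _

lemma ZE_ne_top (φ : ℕ → ℝ≥0∞) (n : ℕ) : ZE d φ n ≠ ⊤ := by
  rw [ZE_eq]; exact tsum_PathsN_ne_top n _ (wt_ne_top φ 0 0)

lemma ZHE_ne_top (φ : ℕ → ℝ≥0∞) (h : Fin d → ℝ) (n : ℕ) : ZHE d φ h n ≠ ⊤ := by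
  rw [ZHE_eq]; exact tsum_PathsN_ne_top n _ (wt_ne_top φ 0 h)

/-- the data of a direction -/
lemma exists_dir (h : Fin d → ℝ) (i : Fin d) :
    ∃ (L : Pt d →+ ℤ) (ρ : Pt d →+ Pt d) (e : Pt d), IsStep e ∧ L e = 1 ∧
      inr h (ctR e) = |h i| ∧
      (∀ s, IsStep s → |L s| ≤ 1) ∧ (∀ x, ρ (ρ x) = x) ∧ (∀ s, IsStep s → IsStep (ρ s)) ∧
      (∀ x, L (ρ x) = L x) ∧
      (∀ x : Pt d, inr h (ctR x) + inr h (ctR (ρ x)) = 2 * (|h i| * (L x : ℝ))) := by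
  obtain ⟨σ, hσ, hσh⟩ : ∃ σ : ℤ, (σ = 1 ∨ σ = -1) ∧ |h i| = σ * h i := by
    rcases le_total 0 (h i) with h1 | h1
    · exact ⟨1, Or.inl rfl, by simp [abs_of_nonneg h1]⟩
    · exact ⟨-1, Or.inr rfl, by simp [abs_of_nonpos h1]⟩
  have hσ2 : σ * σ = 1 := by rcases hσ with rfl | rfl <;> norm_num
  have hσa : |σ| = 1 := by rcases hσ with rfl | rfl <;> norm_num
  refine ⟨AddMonoidHom.mk' (fun x => σ * x i) (by intro a b; simp [mul_add]),
    AddMonoidHom.mk' (fun x j => if j = i then x j else - x j) (by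
      intro a b; funext j; by_cases hj : j = i <;> simp [hj]; ring), Pi.single i σ, ?_, ?_, ?_, ?_,
      ?_, ?_, ?_, ?_⟩
  · unfold IsStep
    rw [Finset.sum_eq_single i]
    · simpa using hσa
    · intro j _ hj; simp [hj]
    · simp
  · simpa using hσ2
  · unfold inr ctR
    rw [Finset.sum_eq_single i]
    · simp [hσh, mul_comm]
    · intro j _ hj; simp [hj]
    · simp
  · intro s hs
    have h2 : (∑ i, |s i|) = 1 := hs
    simp only [AddMonoidHom.mk'_apply, abs_mul, hσa, one_mul]
    rw [← h2]
    exact Finset.single_le_sum (f := fun i => |s i|) (fun _ _ => abs_nonneg _) (Finset.mem_univ i)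
  · intro x; funext j
    by_cases hj : j = i <;> simp [hj]
  · intro s hs
    have h2 : (∑ i, |s i|) = 1 := hs
    unfold IsStep
    rw [← h2]
    refine Finset.sum_congr rfl fun j _ => ?_
    by_cases hj : j = i <;> simp [hj]
  · intro x; simp
  · intro x
    unfold inr ctR
    rw [← Finset.sum_add_distrib, Finset.sum_eq_single i]
    · simp only [AddMonoidHom.mk'_apply, if_true, hσh]
      push_cast
      have : (σ : ℝ) * σ = 1 := by exact_mod_cast hσ2
      linear_combination (-2 * h i * x i) * this
    · intro j _ hj
      simp [hj]
    · simp

lemma straight (φ : ℕ → ℝ≥0∞) (h0 : φ 0 = 0) (h1 : φ 1 ≠ ⊤) (L : Pt d →+ ℤ) (e : Pt d)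
    (hLe : L e = 1) (n : ℕ) : 
    (∀ x ∈ vis (List.replicate n e), 0 ≤ L x) ∧ PotE φ (List.replicate n e) ≠ ⊤ := by
  induction n with
  | zero =>
    constructor
    · intro x hx; simp [vis, visT] at hx; simp [hx]
    · simp only [List.replicate_zero, PotE_eq, vis, visT]
      rw [show (0 : Pt d) ::ₘ 0 = {0} from rfl, pot_sing]
      exact h1
  | succ n ih =>
    rw [List.replicate_succ]
    have hT : ∀ x ∈ visT (e :: List.replicate n e), 0 < L x := by
      intro x hx
      rw [visT_cons, Multiset.mem_map] at hx
      obtain ⟨y, hy, rfl⟩ := hx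
      have := ih.1 y hy
      rw [map_add, hLe]; omega
    constructor
    · intro x hx
      rcases mem_vis_iff.1 hx with rfl | hx
      · simp
      · exact (hT x hx).le
    · rw [PotE_cons h0 _ _ (zero_notMem_visT L hT)]
      exact ENNReal.add_ne_top.2 ⟨h1, ih.2⟩

lemma straight_mem (e : Pt d) (he : IsStep e) (n : ℕ) : List.replicate n e ∈ PathsN d n :=
  ⟨fun s hs => by rw [List.eq_of_mem_replicate hs]; exact he, by simp⟩

lemma wt_ne_zero {φ : ℕ → ℝ≥0∞} {γ : List (Pt d)} (h : PotE φ γ ≠ ⊤) (lam : ℝ) (g : Fin d → ℝ) :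
    wt φ lam g γ ≠ 0 :=
  mul_ne_zero (expNegE_ne_zero h) (by simp [tilt, Real.exp_pos])

lemma ZE_ne_zero (hd : 1 ≤ d) {φ : ℕ → ℝ≥0∞} (h0 : φ 0 = 0) (h1 : φ 1 ≠ ⊤) (n : ℕ) :
    ZE d φ n ≠ 0 := by
  obtain ⟨L, ρ, e, he, hLe, -⟩ := exists_dir (0 : Fin d → ℝ) ⟨0, hd⟩
  rw [ZE_eq]
  intro hz
  have := ENNReal.tsum_eq_zero.1 hz ⟨List.replicate n e, straight_mem e he n⟩
  exact wt_ne_zero (straight φ h0 h1 L e hLe n).2 _ _ this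

lemma ZE_sub {φ : ℕ → ℝ≥0∞} (h0 : φ 0 = 0) (hR : ∀ l m : ℕ, φ l + φ m ≤ φ (l + m)) (n m : ℕ) :
    ZE d φ (n + 1 + m) ≤ (∑' _ : PathsN d 1, (1 : ℝ≥0∞)) * ZE d φ n * ZE d φ m := by
  have hA : 1 * ∑' γ : PathsN d (1 + m), expNegE (pot φ (visT γ.1)) ≤
      (∑' _ : PathsN d 1, (1 : ℝ≥0∞)) * ∑' γ : PathsN d m, expNegE (PotE φ γ.1) := by
    refine G1 (fun x y => x ++ y) (u := fun _ => 1) (f := fun γ => expNegE (pot φ (visT γ)))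
      (v := fun γ => expNegE (PotE φ γ)) 1 ?_
    rintro γ ⟨hγ, hl⟩
    cases γ with
    | nil => simp at hl; omega
    | cons s γ =>
      refine ⟨[s], ⟨fun t ht => hγ t (by simp at ht; simp [ht]), rfl⟩, γ,
        ⟨fun t ht => hγ t (by simp [ht]), by simp at hl; omega⟩, rfl, ?_⟩
      rw [visT_cons, pot_map φ _ (add_right_injective _), PotE_eq]
  have hB : 1 * ∑' γ : PathsN d (n + (1 + m)), expNegE (PotE φ γ.1) ≤
      (∑' γ : PathsN d n, expNegE (PotE φ γ.1)) *
        ∑' γ : PathsN d (1 + m), expNegE (pot φ (visT γ.1)) := by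
    refine G1 (fun x y => x ++ y) (u := fun γ => expNegE (PotE φ γ))
      (v := fun γ => expNegE (pot φ (visT γ)))
      (f := fun γ => expNegE (PotE φ γ)) 1 ?_
    rintro γ ⟨hγ, hl⟩
    have hγ2 := hγ
    rw [← List.take_append_drop n γ, IsPath_append] at hγ2
    refine ⟨γ.take n, ⟨hγ2.1, by simp; omega⟩, γ.drop n, ⟨hγ2.2, by simp; omega⟩,
      List.take_append_drop n γ, ?_⟩
    rw [one_mul, ← expNegE_add]
    have := PotE_append3 h0 hR (γ.take n) (γ.drop n)
    rw [List.take_append_drop] at this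
    exact expNegE_anti this
  rw [one_mul] at hA hB
  unfold ZE
  rw [add_assoc]
  refine hB.trans ?_
  calc _ ≤ (∑' γ : PathsN d n, expNegE (PotE φ γ.1)) * ((∑' _ : PathsN d 1, (1 : ℝ≥0∞)) *
      ∑' γ : PathsN d m, expNegE (PotE φ γ.1)) := by gcongr
    _ = _ := by ring

lemma ZE_lower (hd : 1 ≤ d) {φ : ℕ → ℝ≥0∞} (h0 : φ 0 = 0) (h1 : φ 1 ≠ ⊤)
    (hR : ∀ l m : ℕ, φ l + φ m ≤ φ (l + m)) (lam0 : ℝ)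
    (hlam0 : Filter.Tendsto (fun n : ℕ => Real.log (ZE d φ n).toReal / n) Filter.atTop
      (nhds lam0)) :
    ∃ c : ℝ, 0 < c ∧ ∀ n : ℕ, c * Real.exp (lam0 * n) ≤ (ZE d φ n).toReal := by
  set C := (∑' _ : PathsN d 1, (1 : ℝ≥0∞)) with hC
  have hCt : C ≠ ⊤ := tsum_PathsN_ne_top 1 (fun _ => 1) (fun _ => ENNReal.one_ne_top)
  have hC0 : C ≠ 0 := by
    obtain ⟨L, ρ, e, he, hLe, -⟩ := exists_dir (0 : Fin d → ℝ) ⟨0, hd⟩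
    intro hz
    have := ENNReal.tsum_eq_zero.1 hz ⟨List.replicate 1 e, straight_mem e he 1⟩
    exact one_ne_zero this
  set c := C.toReal with hc
  have hcpos : 0 < c := ENNReal.toReal_pos hC0 hCt
  set z : ℕ → ℝ := fun n => (ZE d φ n).toReal with hz
  have hzpos : ∀ n, 0 < z n := fun n => ENNReal.toReal_pos (ZE_ne_zero hd h0 h1 n) (ZE_ne_top φ n)
  have hsub : ∀ n m, z (n + 1 + m) ≤ c * z n * z m := by
    intro n m
    have := ENNReal.toReal_mono (ENNReal.mul_ne_top (ENNReal.mul_ne_top hCt (ZE_ne_top φ n))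
      (ZE_ne_top φ m)) (ZE_sub h0 hR n m)
    simpa [ENNReal.toReal_mul] using this
  let u : ℕ → ℝ := fun n => Nat.casesOn n 0 (fun k => Real.log (c * z k))
  have hu : Subadditive u := by
    intro m n
    cases m with
    | zero => simp [u]
    | succ m =>
      cases n with
      | zero => simp [u]
      | succ n =>
        show Real.log (c * z (m + 1 + n)) ≤ Real.log (c * z m) + Real.log (c * z n)
        rw [← Real.log_mul (mul_pos hcpos (hzpos _)).ne' (mul_pos hcpos (hzpos _)).ne']
        apply Real.log_le_log (mul_pos hcpos (hzpos _))
        have := mul_le_mul_of_nonneg_left (hsub m n) hcpos.le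
        linarith
  have hut : Tendsto (fun n => u n / n) atTop (𝓝 lam0) := by
    rw [← tendsto_add_atTop_iff_nat 1]
    have e : (fun n : ℕ => u (n+1) / ((n+1 : ℕ) : ℝ)) =ᶠ[atTop] fun n : ℕ =>
        Real.log c * (1 / ((n : ℝ) + 1)) + (Real.log (z n) / n) * ((n : ℝ) / (n + 1)) := by
      filter_upwards [eventually_gt_atTop 0] with n hn
      show Real.log (c * z n) / _ = _
      rw [Real.log_mul hcpos.ne' (hzpos n).ne']
      push_cast
      have : (n : ℝ) ≠ 0 := by positivity
      field_simp
    rw [tendsto_congr' e]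
    have := (tendsto_one_div_add_atTop_nhds_zero_nat (𝕜 := ℝ)).const_mul (Real.log c)
    have h2 := hlam0.mul (tendsto_natCast_div_add_atTop (1 : ℝ))
    simpa using this.add h2
  have hbdd : BddBelow (Set.range fun n => u n / n) := hut.bddBelow_range
  have hlim : hu.lim = lam0 := tendsto_nhds_unique (hu.tendsto_lim hbdd) hut
  refine ⟨Real.exp lam0 / c, by positivity, fun n => ?_⟩
  have h3 := hu.lim_le_div hbdd (n := n+1) (by omega)
  rw [hlim, le_div_iff₀ (by positivity)] at h3
  have h4 : lam0 * ((n + 1 : ℕ) : ℝ) ≤ Real.log (c * z n) := h3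
  rw [Real.le_log_iff_exp_le (mul_pos hcpos (hzpos n))] at h4
  have h5 : Real.exp lam0 * Real.exp (lam0 * n) ≤ c * z n := by
    rw [← Real.exp_add]
    convert h4 using 2
    push_cast; ring
  rw [div_mul_eq_mul_div, div_le_iff₀ hcpos]
  linarith

lemma sum_lt (φ : ℕ → ℝ≥0∞) (lam : ℝ) (N : ℕ) :
    ∑ n ∈ Finset.range N, ENNReal.ofReal (Real.exp (-(lam * n))) * ZE d φ n ≤
      ∑' γ : {γ : List (Pt d) | IsPath γ ∧ γ.length < N}, wt φ lam 0 γ.1 := by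
  induction N with
  | zero => simp
  | succ N ih =>
    rw [Finset.sum_range_succ]
    have hsub : {γ : List (Pt d) | IsPath γ ∧ γ.length < N + 1} =
        {γ : List (Pt d) | IsPath γ ∧ γ.length < N} ∪ PathsN d N := by
      ext γ
      simp only [Set.mem_ofPred_eq, Set.mem_union, PathsN]
      constructor
      · rintro ⟨a, b⟩
        rcases Nat.lt_succ_iff_lt_or_eq.1 b with h | h
        · exact Or.inl ⟨a, h⟩
        · exact Or.inr ⟨a, h⟩
      · rintro (⟨a, b⟩ | ⟨a, b⟩)
        · exact ⟨a, by omega⟩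
        · exact ⟨a, by omega⟩
    rw [hsub, Summable.tsum_union_disjoint (f := wt φ lam 0) _ ENNReal.summable ENNReal.summable]
    · refine add_le_add ih (le_of_eq ?_)
      rw [ZE_eq, ← ENNReal.tsum_mul_left]
      refine tsum_congr fun γ => ?_
      rw [wt_split φ lam, γ.2.2]
    · rw [Set.disjoint_left]
      rintro γ ⟨_, h⟩ ⟨_, h'⟩
      omega

lemma growth (G : ℕ → ℝ) (hG : ∀ n m, G n * G m ≤ G (n + m)) (hG1 : 0 < G 1)
    (lam0 : ℝ) (n0 : ℕ) (hn0 : 1 ≤ n0) (h : Real.exp (lam0 * n0) < G n0) :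
    ∃ lam : ℝ, lam0 < lam ∧ ∃ c : ℝ, 0 < c ∧ ∀ n : ℕ, 1 ≤ n → c * Real.exp (lam * n) ≤ G n := by
  have hGn : 0 < G n0 := (Real.exp_pos _).trans h
  have hn0' : (0 : ℝ) < n0 := by exact_mod_cast hn0
  set lam := Real.log (G n0) / n0 with hlam
  have hexp : Real.exp (lam * n0) = G n0 := by
    rw [hlam, div_mul_cancel₀ _ hn0'.ne', Real.exp_log hGn]
  set t := G 1 * Real.exp (-lam) with ht
  have htpos : 0 < t := by positivity
  have hr : ∀ r : ℕ, t ^ (r+1) * Real.exp (lam * (r + 1 : ℕ)) ≤ G (r + 1) := by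
    intro r
    have e1 : t ^ (r+1) * Real.exp (lam * (r + 1 : ℕ)) = G 1 ^ (r+1) := by
      rw [ht, mul_pow, ← Real.exp_nat_mul, mul_assoc, ← Real.exp_add]
      rw [show ((r + 1 : ℕ) : ℝ) * -lam + lam * ((r+1 : ℕ) : ℝ) = 0 by ring]
      simp
    rw [e1]
    clear e1
    induction r with
    | zero => simp
    | succ r ih =>
      rw [pow_succ]
      exact (mul_le_mul_of_nonneg_right ih hG1.le).trans (hG _ _)
  refine ⟨lam, ?_, (min 1 t) ^ n0, by positivity, ?_⟩
  · rw [hlam, lt_div_iff₀ hn0']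
    exact (Real.lt_log_iff_exp_lt hGn).2 h
  intro n hn
  obtain ⟨r, q, hrlt, rfl⟩ : ∃ r q, r < n0 ∧ n = (r + 1) + n0 * q := by
    refine ⟨(n-1) % n0, (n-1) / n0, Nat.mod_lt _ hn0, ?_⟩
    have := Nat.mod_add_div (n-1) n0
    omega
  clear hn
  have hq : min 1 t ^ n0 * Real.exp (lam * (r+1 : ℕ)) ≤ G (r+1) := by
    refine le_trans ?_ (hr r)
    gcongr
    calc min 1 t ^ n0 ≤ min 1 t ^ (r+1) :=
          pow_le_pow_of_le_one (le_min zero_le_one htpos.le) (min_le_left _ _) hrlt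
      _ ≤ t ^ (r+1) := by gcongr; exact min_le_right _ _
  induction q with
  | zero => simpa using hq
  | succ q ih =>
    have := (mul_le_mul_of_nonneg_right ih hGn.le).trans (hG _ _)
    rw [show r + 1 + n0 * (q+1) = r + 1 + n0 * q + n0 by ring]
    refine le_trans (le_of_eq ?_) this
    rw [← hexp, mul_assoc, ← Real.exp_add]
    congr 2
    push_cast; ring


end Aux3

section Aux4
variable {d : ℕ}

lemma kappa_lemma (b z : ℕ → ℝ) (hz : ∀ n, 0 ≤ z n) (h0 : b 0 ≤ z 0) (h1 : ∀ n, 1 ≤ n → b n < z n)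
    (δ : ℝ) (hδ : 0 < δ) (hev : ∀ᶠ n : ℕ in atTop, b n ≤ Real.exp (-(δ * n)) * z n) :
    ∃ κ : ℝ, 0 < κ ∧ ∀ n : ℕ, b n ≤ Real.exp (-(κ * n)) * z n := by
  obtain ⟨N, hN⟩ := eventually_atTop.1 hev
  have hA : ∀ n ∈ Finset.range N, ∀ᶠ κ : ℝ in 𝓝[>] 0, b n ≤ Real.exp (-(κ * n)) * z n := by
    intro n _
    rcases Nat.eq_zero_or_pos n with rfl | hn
    · simpa using h0
    · have ht : Tendsto (fun κ : ℝ => Real.exp (-(κ * n)) * z n) (𝓝[>] 0) (𝓝 (z n)) := by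
        have hc : Continuous (fun κ : ℝ => Real.exp (-(κ * n)) * z n) := by fun_prop
        have := (hc.tendsto 0).mono_left (nhdsWithin_le_nhds (s := Set.Ioi 0))
        simpa using this
      filter_upwards [ht.eventually (lt_mem_nhds (h1 n hn))] with κ hκ
      exact hκ.le
  have hA' := (Filter.eventually_all_finset (Finset.range N)).2 hA
  have hB : ∀ᶠ κ : ℝ in 𝓝[>] 0, κ < δ :=
    (eventually_lt_nhds hδ).filter_mono nhdsWithin_le_nhds
  have hC : ∀ᶠ κ : ℝ in 𝓝[>] 0, 0 < κ := eventually_mem_nhdsWithin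
  obtain ⟨κ, h2, h3, h4⟩ := (hA'.and (hB.and hC)).exists
  refine ⟨κ, h4, fun n => ?_⟩
  by_cases hn : n < N
  · exact h2 n (Finset.mem_range.2 hn)
  · refine (hN n (not_lt.1 hn)).trans (mul_le_mul_of_nonneg_right ?_ (hz n))
    apply Real.exp_le_exp.2
    have : κ * n ≤ δ * n := by gcongr
    linarith

lemma l1_disp (γ : List (Pt d)) (hγ : IsPath γ) : ∑ i, |disp γ i| ≤ γ.length := by
  induction γ with
  | nil => simp [disp]
  | cons s γ ih =>
    have h1 := ih (fun t ht => hγ t (by simp [ht]))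
    have h2 : ∑ i, |s i| = 1 := hγ s (by simp)
    have h3 : ∑ i, |disp (s :: γ) i| ≤ ∑ i, (|s i| + |disp γ i|) := by
      refine Finset.sum_le_sum fun i _ => ?_
      simp only [disp, List.sum_cons, Pi.add_apply]
      exact abs_add_le _ _
    rw [Finset.sum_add_distrib, h2] at h3
    rw [List.length_cons]
    push_cast
    linarith

lemma l2_disp (γ : List (Pt d)) (hγ : IsPath γ) :
    ∑ i, (disp γ i : ℝ) ^ 2 ≤ (γ.length : ℝ) ^ 2 := by
  have h1 := l1_disp γ hγ
  have h2 : ∑ i, (disp γ i) ^ 2 ≤ ∑ i, (γ.length : ℤ) * |disp γ i| := by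
    refine Finset.sum_le_sum fun i _ => ?_
    have h3 : |disp γ i| ≤ γ.length :=
      (Finset.single_le_sum (f := fun i => |disp γ i|) (fun _ _ => abs_nonneg _)
        (Finset.mem_univ i)).trans h1
    rw [← sq_abs, sq]
    exact mul_le_mul_of_nonneg_right h3 (abs_nonneg _)
  rw [← Finset.mul_sum] at h2
  have h3 : ∑ i, (disp γ i) ^ 2 ≤ (γ.length : ℤ) ^ 2 := by
    rw [sq (γ.length : ℤ)]
    exact h2.trans (mul_le_mul_of_nonneg_left h1 (by positivity))
  exact_mod_cast h3

lemma bad_imp (h : Fin d → ℝ) (η : ℝ) (hη : 0 < η) (γ : List (Pt d)) (hγ : IsPath γ) (n : ℕ)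
    (hn : 1 ≤ n) (hl : γ.length = n)
    (hb : √(∑ i, (h i / η) ^ 2 - 1) ≤ nrm (fun i => (disp γ i : ℝ) / n - h i / η)) :
    inr h (ctR (disp γ)) ≤ η * n := by
  unfold nrm at hb
  have hnn : (0 : ℝ) < n := by exact_mod_cast hn
  have h1 := (Real.sqrt_le_sqrt_iff (by positivity)).1 hb
  have h2 : ∑ i, ((disp γ i : ℝ) / n - h i / η) ^ 2 =
      (∑ i, (disp γ i : ℝ) ^ 2) / n ^ 2 - 2 / (η * n) * inr h (ctR (disp γ)) +
        ∑ i, (h i / η) ^ 2 := by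
    unfold inr ctR
    rw [Finset.sum_div, Finset.mul_sum, ← Finset.sum_sub_distrib, ← Finset.sum_add_distrib]
    refine Finset.sum_congr rfl fun i _ => ?_
    field_simp
    ring
  have h3 := l2_disp γ hγ
  rw [hl] at h3
  have h4 : (∑ i, (disp γ i : ℝ) ^ 2) / (n : ℝ) ^ 2 ≤ 1 := (div_le_one (by positivity)).2 h3
  have h5 : 2 / (η * n) * inr h (ctR (disp γ)) ≤ 2 := by linarith
  rw [div_mul_eq_mul_div, div_le_iff₀ (by positivity)] at h5
  linarith

lemma disp_replicate (n : ℕ) (e : Pt d) (h : Fin d → ℝ) :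
    inr h (ctR (disp (List.replicate n e))) = n * inr h (ctR e) := by
  unfold inr ctR disp
  rw [Finset.mul_sum]
  refine Finset.sum_congr rfl fun i _ => ?_
  simp
  ring

lemma finish (φ : ℕ → ℝ≥0∞) (hN0 : φ 0 = 0) (hφ1 : φ 1 ≠ ⊤) (lam0 : ℝ)
    (hlam0 : Filter.Tendsto (fun n : ℕ => Real.log (ZE d φ n).toReal / n) Filter.atTop
      (nhds lam0)) (h : Fin d → ℝ)
    (hg : ∃ lam : ℝ, lam0 < lam ∧ ∃ c : ℝ, 0 < c ∧ ∀ n : ℕ, 1 ≤ n →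
      c * Real.exp (lam * n) ≤ (ZHE d φ h n).toReal) :
    ∃ v : Fin d → ℝ, v ≠ 0 ∧ ∃ κ : ℝ, 0 < κ ∧ ∃ ε : ℝ, 0 < ε ∧ ε < nrm v ∧
      ∀ n : ℕ,
        (∑' γ : {γ : List (Pt d) // γ ∈ PathsN d n ∧
            ε ≤ nrm (fun i => (disp γ i : ℝ) / n - v i)}, wHE φ h (γ : List (Pt d)))
          ≤ ENNReal.ofReal (Real.exp (-(κ * n))) * ZHE d φ h n := by
  obtain ⟨lam, hlam, c, hc, hgr⟩ := hg
  set δ := (lam - lam0) / 4 with hδ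
  have hδpos : 0 < δ := by rw [hδ]; linarith
  have hZup : ∀ᶠ n : ℕ in atTop, (ZE d φ n).toReal ≤ Real.exp ((lam0 + δ) * n) := by
    filter_upwards [hlam0.eventually (gt_mem_nhds (show lam0 < lam0 + δ by linarith)),
      eventually_gt_atTop 0] with n hn hn0
    have hn0' : (0 : ℝ) < n := by exact_mod_cast hn0
    rw [div_lt_iff₀ hn0'] at hn
    exact (Real.le_exp_log _).trans (Real.exp_le_exp.2 hn.le)
  have hcs : ∀ᶠ n : ℕ in atTop, Real.exp (-(δ * n)) < c := by
    have ht : Tendsto (fun n : ℕ => Real.exp (-(δ * n))) atTop (𝓝 0) := by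
      refine Real.tendsto_exp_atBot.comp ?_
      refine tendsto_neg_atTop_atBot.comp ?_
      exact tendsto_natCast_atTop_atTop.const_mul_atTop hδpos
    exact ht.eventually (gt_mem_nhds hc)
  have hlow : ∀ᶠ n : ℕ in atTop, Real.exp ((lam0 + 3 * δ) * n) < (ZHE d φ h n).toReal := by
    filter_upwards [hcs, eventually_ge_atTop 1] with n hn hn1
    refine lt_of_lt_of_le ?_ (hgr n hn1)
    calc Real.exp ((lam0 + 3 * δ) * n) = Real.exp (-(δ * n)) * Real.exp (lam * n) := by
          rw [← Real.exp_add]; congr 1; rw [hδ]; ring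
      _ < _ := by gcongr
  have hh : h ≠ 0 := by
    rintro rfl
    obtain ⟨n, h1, h2, h3⟩ := (hZup.and (hlow.and (eventually_ge_atTop 1))).exists
    rw [ZHE_eq, ← ZE_eq] at h2
    have := h2.trans_le h1
    rw [Real.exp_lt_exp] at this
    have : (1 : ℝ) ≤ n := by exact_mod_cast h3
    nlinarith
  obtain ⟨i, hi⟩ := Function.ne_iff.1 hh
  rw [Pi.zero_apply] at hi
  have hip : 0 < |h i| := abs_pos.2 hi
  set η := min δ (|h i| / 2) with hη
  have hηpos : 0 < η := lt_min hδpos (by positivity)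
  have hηδ : η ≤ δ := min_le_left _ _
  have hηi : η ≤ |h i| / 2 := min_le_right _ _
  have hbig : 4 ≤ ∑ j, (h j / η) ^ 2 := by
    have h1 : (h i / η) ^ 2 ≤ ∑ j, (h j / η) ^ 2 :=
      Finset.single_le_sum (f := fun j => (h j / η) ^ 2) (fun _ _ => sq_nonneg _) (Finset.mem_univ i)
    refine le_trans ?_ h1
    rw [← sq_abs, abs_div, abs_of_pos hηpos]
    have : 2 ≤ |h i| / η := by rw [le_div_iff₀ hηpos]; linarith
    nlinarith
  obtain ⟨L, ρ, e, he, hLe, hhe, -⟩ := exists_dir h i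
  set ε := √(∑ j, (h j / η) ^ 2 - 1) with hε
  set bad : ℕ → ℝ≥0∞ := fun n => ∑' γ : {γ : List (Pt d) // γ ∈ PathsN d n ∧
            ε ≤ nrm (fun i => (disp γ i : ℝ) / n - h i / η)}, wHE φ h (γ : List (Pt d)) with hbad
  have hbadle : ∀ n, bad n ≤ ZHE d φ h n := by
    intro n
    exact G0 (fun γ => (⟨γ.1, γ.2.1⟩ : PathsN d n)) (fun a b hab => Subtype.ext (by simpa using hab))
      (fun _ => le_rfl)
  have hbadtop : ∀ n, bad n ≠ ⊤ := fun n => ne_top_of_le_ne_top (ZHE_ne_top φ h n) (hbadle n)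
  have hbadlt : ∀ n, 1 ≤ n → bad n < ZHE d φ h n := by
    intro n hn
    have hnn : (0 : ℝ) < n := by exact_mod_cast hn
    set γ0 := List.replicate n e with hγ0
    have hγ0m := straight_mem e he n
    have hw0 : wHE φ h γ0 ≠ 0 := by
      rw [wHE_eq]; exact wt_ne_zero (straight φ hN0 hφ1 L e hLe n).2 _ _
    have hle : bad n + wHE φ h γ0 ≤ ZHE d φ h n := by
      have e1 : bad n + wHE φ h γ0 = ∑' x : Option {γ : List (Pt d) // γ ∈ PathsN d n ∧
            ε ≤ nrm (fun i => (disp γ i : ℝ) / n - h i / η)},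
            (x.elim (wHE φ h γ0) (fun γ => wHE φ h γ.1)) := by
        rw [← (Equiv.optionEquivSumPUnit.{0} _).symm.tsum_eq,
          Summable.tsum_sum ENNReal.summable ENNReal.summable, tsum_fintype (β := PUnit)]
        simp [hbad]
      rw [e1]
      refine G0 (fun x => x.elim (⟨γ0, hγ0m⟩ : PathsN d n) (fun γ => ⟨γ.1, γ.2.1⟩)) ?_ ?_
      · have hne : ∀ γ : {γ : List (Pt d) // γ ∈ PathsN d n ∧
            ε ≤ nrm (fun i => (disp γ i : ℝ) / n - h i / η)}, γ.1 ≠ γ0 := by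
          rintro ⟨γ, hγ, hb⟩ rfl
          have := bad_imp h η hηpos γ0 hγ.1 n hn hγ.2 hb
          rw [disp_replicate, hhe] at this
          nlinarith
        rintro (_ | a) (_ | b) hab
        · rfl
        · exact absurd (congrArg Subtype.val hab).symm (hne b)
        · exact absurd (congrArg Subtype.val hab) (hne a)
        · have := congrArg Subtype.val hab
          exact congrArg some (Subtype.ext this)
      · rintro (_ | a)
        · exact le_rfl
        · exact le_rfl
    exact lt_of_lt_of_le (ENNReal.lt_add_right (hbadtop n) hw0) hle
  have hbadup : ∀ n, 1 ≤ n → bad n ≤ ENNReal.ofReal (Real.exp (η * n)) * ZE d φ n := by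
    intro n hn
    unfold ZE
    rw [← ENNReal.tsum_mul_left]
    refine G0 (fun γ => (⟨γ.1, γ.2.1⟩ : PathsN d n)) (fun a b hab => Subtype.ext (by simpa using hab)) ?_
    rintro ⟨γ, hγ, hb⟩
    have := bad_imp h η hηpos γ hγ.1 n hn hγ.2 hb
    unfold wHE
    rw [mul_comm]
    gcongr
  obtain ⟨κ, hκ, hfin⟩ := kappa_lemma (fun n => (bad n).toReal) (fun n => (ZHE d φ h n).toReal)
    (fun n => ENNReal.toReal_nonneg) (ENNReal.toReal_mono (ZHE_ne_top φ h 0) (hbadle 0))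
    (fun n hn => (ENNReal.toReal_lt_toReal (hbadtop n) (ZHE_ne_top φ h n)).2 (hbadlt n hn))
    δ hδpos (by
      filter_upwards [hZup, hlow, eventually_ge_atTop 1] with n h1 h2 h3
      have h4 := ENNReal.toReal_mono (ENNReal.mul_ne_top ENNReal.ofReal_ne_top (ZE_ne_top φ n))
        (hbadup n h3)
      rw [ENNReal.toReal_mul, ENNReal.toReal_ofReal (Real.exp_pos _).le] at h4
      calc (bad n).toReal ≤ Real.exp (η * n) * (ZE d φ n).toReal := h4
        _ ≤ Real.exp (δ * n) * Real.exp ((lam0 + δ) * n) := by gcongr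
        _ = Real.exp (-(δ * n)) * Real.exp ((lam0 + 3 * δ) * n) := by
          rw [← Real.exp_add, ← Real.exp_add]; congr 1; ring
        _ ≤ _ := by gcongr)
  refine ⟨fun j => h j / η, ?_, κ, hκ, ε, Real.sqrt_pos.2 (by linarith), ?_, ?_⟩
  · intro hv
    have := congrFun hv i
    simp only [Pi.zero_apply, div_eq_zero_iff] at this
    rcases this with h1 | h1
    · exact hi h1
    · exact hηpos.ne' h1
  · exact Real.sqrt_lt_sqrt (by linarith) (by linarith)
  · intro n
    rw [← ENNReal.toReal_le_toReal (hbadtop n)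
      (ENNReal.mul_ne_top ENNReal.ofReal_ne_top (ZHE_ne_top φ h n)), ENNReal.toReal_mul,
      ENNReal.toReal_ofReal (Real.exp_pos _).le]
    exact hfin n

lemma repulsive (hd : 1 ≤ d) (φ : ℕ → ℝ≥0∞) (h0 : φ 0 = 0) (h1 : φ 1 ≠ ⊤)
    (hR : ∀ l m : ℕ, φ l + φ m ≤ φ (l + m)) (lam0 : ℝ)
    (hlam0 : Filter.Tendsto (fun n : ℕ => Real.log (ZE d φ n).toReal / n) Filter.atTop
      (nhds lam0)) (h : Fin d → ℝ) (hh : h ≠ 0) :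
    ∃ lam : ℝ, lam0 < lam ∧ ∃ c : ℝ, 0 < c ∧ ∀ n : ℕ, 1 ≤ n →
      c * Real.exp (lam * n) ≤ (ZHE d φ h n).toReal := by
  obtain ⟨i, hi⟩ := Function.ne_iff.1 hh
  rw [Pi.zero_apply] at hi
  have ha : 0 < |h i| := abs_pos.2 hi
  obtain ⟨L, ρ, e, he, hLe, hhe, hL, hρ, hρs, hρL, hg⟩ := exists_dir h i
  set a := |h i| with ha_def
  have hq0 := expNegE_ne_zero h1
  have hqt := expNegE_ne_top (φ 1)
  set q := expNegE (φ 1) with hq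
  set b : ℕ → ℝ≥0∞ := fun n => ∑' γ : BrN L n, wt φ 0 h γ.1 with hb
  have hex : ∃ n0 : ℕ, q * ENNReal.ofReal (Real.exp (lam0 * n0)) < b n0 := by
    by_contra hcon
    push Not at hcon
    obtain ⟨c, hc, hcl⟩ := ZE_lower hd h0 h1 hR lam0 hlam0
    set K := ENNReal.ofReal (Real.exp (∑' k : ℕ, Real.exp (-(a * (k+1))))) with hK
    have main : ∀ N : ℕ, 1 ≤ N → (q ^ 2 * ENNReal.ofReal (Real.exp (-lam0 - 1))) *
        ((N : ℝ≥0∞) * ENNReal.ofReal (c * Real.exp (-1))) ≤ K * K := by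
      intro N hN
      have hNp : (0 : ℝ) < N := by exact_mod_cast hN
      set lam := lam0 + 1 / (N : ℝ) with hlam
      have hlt : lam0 < lam := by
        have : 0 < 1 / (N : ℝ) := by positivity
        linarith
      have hB : ∀ k : ℕ, ∑' γ : Br L (k+1), wt φ lam 0 γ.1 ≤
          expNegE (φ 1) * ENNReal.ofReal (Real.exp (-(a * (k+1)))) := by
        intro k
        have h2 := (B_tilt φ L lam a h ρ hρ hρs hρL hg (k+1)).trans
          (B_small h0 h1 L lam lam0 hlt h hcon k)
        calc _ = ENNReal.ofReal (Real.exp (-(a * (k+1)))) * (ENNReal.ofReal (Real.exp (a * (k+1 : ℕ))) *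
              ∑' γ : Br L (k+1), wt φ lam 0 γ.1) := by
              rw [← mul_assoc, ← ENNReal.ofReal_mul (Real.exp_pos _).le, ← Real.exp_add]
              push_cast
              rw [neg_add_cancel]; simp
          _ ≤ ENNReal.ofReal (Real.exp (-(a * (k+1)))) * expNegE (φ 1) := by gcongr
          _ = _ := mul_comm _ _
      have hS := hw_bound h0 h1 hR L lam a ha hB N
      have hgen := hw_general h0 hR L hL e he hLe lam N
      have hsum : (N : ℝ≥0∞) * ENNReal.ofReal (c * Real.exp (-1)) ≤
          ∑' γ : {γ : List (Pt d) | IsPath γ ∧ γ.length < N}, wt φ lam 0 γ.1 := by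
        refine le_trans ?_ (sum_lt φ lam N)
        rw [← nsmul_eq_mul, ← Finset.card_range N, ← Finset.sum_const, Finset.card_range]
        refine Finset.sum_le_sum fun n hn => ?_
        rw [← ENNReal.ofReal_toReal (ZE_ne_top φ n), ← ENNReal.ofReal_mul (Real.exp_pos _).le]
        apply ENNReal.ofReal_le_ofReal
        calc c * Real.exp (-1) ≤ c * Real.exp (-(lam * n) + lam0 * n) := by
              gcongr
              have hn' : (n : ℝ) ≤ N := by exact_mod_cast (Finset.mem_range.1 hn).le
              have : (n : ℝ) / N ≤ 1 := (div_le_one hNp).2 hn'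
              have e2 : -(lam * n) + lam0 * n = - ((n : ℝ) / N) := by rw [hlam]; ring
              linarith
          _ = Real.exp (-(lam * n)) * (c * Real.exp (lam0 * n)) := by rw [Real.exp_add]; ring
          _ ≤ _ := by gcongr; exact hcl n
      have hl1 : lam ≤ lam0 + 1 := by
        have : 1 / (N : ℝ) ≤ 1 := (div_le_one hNp).2 (by exact_mod_cast hN)
        linarith
      calc _ ≤ (q ^ 2 * ENNReal.ofReal (Real.exp (-lam))) *
          ∑' γ : {γ : List (Pt d) | IsPath γ ∧ γ.length < N}, wt φ lam 0 γ.1 := by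
            gcongr
            linarith
        _ ≤ _ := hgen
        _ ≤ K * K := mul_le_mul' hS hS
    set A := (q ^ 2 * ENNReal.ofReal (Real.exp (-lam0 - 1))) * ENNReal.ofReal (c * Real.exp (-1)) with hA
    have hA0 : A ≠ 0 := by
      refine mul_ne_zero (mul_ne_zero (pow_ne_zero _ hq0) ?_) ?_
      · simp [Real.exp_pos]
      · simp only [ne_eq, ENNReal.ofReal_eq_zero, not_le]; positivity
    have hKK : K * K ≠ ⊤ := ENNReal.mul_ne_top ENNReal.ofReal_ne_top ENNReal.ofReal_ne_top
    obtain ⟨N, hN⟩ := ENNReal.exists_nat_mul_gt hA0 hKK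
    have hN1 : 1 ≤ N := by
      rcases Nat.eq_zero_or_pos N with rfl | h
      · simp at hN
      · exact h
    have := main N hN1
    refine absurd (hN.trans_le (le_trans (le_of_eq ?_) this)) (lt_irrefl _)
    rw [hA]; ring
  obtain ⟨n0, hn0⟩ := hex
  have hbZ : ∀ n, b n ≤ ZHE d φ h n := by
    intro n
    rw [ZHE_eq]
    exact ENNReal.tsum_mono_subtype (wt φ 0 h)
      (fun γ hγ => ⟨hγ.2.choose_spec.1, hγ.1⟩)
  have hbt : ∀ n, b n ≠ ⊤ := fun n => ne_top_of_le_ne_top (ZHE_ne_top φ h n) (hbZ n)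
  have hn01 : 1 ≤ n0 := by
    rcases Nat.eq_zero_or_pos n0 with rfl | h'
    · exfalso
      have hs : BrN L 0 ⊆ {[]} := fun γ hγ => List.eq_nil_of_length_eq_zero hγ.1
      have h2 : b 0 ≤ wt φ 0 h [] := by
        refine (ENNReal.tsum_mono_subtype (wt φ 0 h) hs).trans ?_
        rw [tsum_singleton]
      have h3 : wt φ 0 h ([] : List (Pt d)) = q := by
        unfold wt
        rw [PotE_eq, show vis ([] : List (Pt d)) = {0} from rfl, pot_sing]
        simp [tilt, disp, inr, ctR, hq]
      rw [h3] at h2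
      simp at hn0
      exact absurd (hn0.trans_le h2) (lt_irrefl _)
    · exact h'
  have hqr : 0 < q.toReal := ENNReal.toReal_pos hq0 hqt
  have hG := growth (fun n => (b n).toReal / q.toReal) (by
      intro n m
      have h2 := ENNReal.toReal_mono (ENNReal.mul_ne_top hqt (hbt (n+m))) (b_super h0 L 0 h n m)
      rw [ENNReal.toReal_mul, ENNReal.toReal_mul] at h2
      rw [div_mul_div_comm, div_le_div_iff₀ (by positivity) hqr]
      calc _ ≤ (q.toReal * (b (n+m)).toReal) * q.toReal := by gcongr
        _ = _ := by ring) (by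
      refine div_pos (ENNReal.toReal_pos ?_ (hbt 1)) hqr
      intro hz
      have hm : [e] ∈ BrN L 1 := by
        refine ⟨rfl, 1, fun s hs => ?_, ?_, ?_⟩
        · simp at hs; rw [hs]; exact he
        · intro x hx; simp [visT] at hx; simp [hx, hLe]
        · simp [disp, hLe]
      have h2 := ENNReal.tsum_eq_zero.1 hz ⟨[e], hm⟩
      exact wt_ne_zero (straight φ h0 h1 L e hLe 1).2 _ _ h2) lam0 n0 hn01 (by
      rw [lt_div_iff₀ hqr]
      have h2 := (ENNReal.toReal_lt_toReal (ENNReal.mul_ne_top hqt ENNReal.ofReal_ne_top) (hbt n0)).2 hn0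
      rw [ENNReal.toReal_mul, ENNReal.toReal_ofReal (Real.exp_pos _).le] at h2
      linarith)
  obtain ⟨lam, hlam, c, hc, hcl⟩ := hG
  refine ⟨lam, hlam, q.toReal * c, by positivity, fun n hn => ?_⟩
  have h2 := hcl n hn
  rw [le_div_iff₀ hqr] at h2
  have h3 := ENNReal.toReal_mono (ZHE_ne_top φ h n) (hbZ n)
  linarith

lemma exists_path (x : Pt d) : ∃ γ : List (Pt d), IsPath γ ∧ disp γ = x := by
  let P : AddSubmonoid (Pt d) :=
    { carrier := {x | ∃ γ : List (Pt d), IsPath γ ∧ disp γ = x}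
      zero_mem' := ⟨[], by simp [IsPath], by simp [disp]⟩
      add_mem' := by
        rintro x y ⟨a, ha, rfl⟩ ⟨b, hb, rfl⟩
        exact ⟨a ++ b, IsPath_append.2 ⟨ha, hb⟩, disp_append a b⟩ }
  have hst : ∀ s, IsStep s → s ∈ P := by
    intro s hs
    exact ⟨[s], fun t ht => by simp at ht; rw [ht]; exact hs, by simp [disp]⟩
  have hsg : ∀ (i : Fin d), IsStep (Pi.single i 1 : Pt d) := by
    intro i
    unfold IsStep
    rw [Finset.sum_eq_single i]
    · simp
    · intro j _ hj; simp [hj]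
    · simp
  have hsingle : ∀ (i : Fin d) (n : ℕ), Pi.single i (n : ℤ) ∈ P ∧ Pi.single i (-(n : ℤ)) ∈ P := by
    intro i n
    induction n with
    | zero => simp [P.zero_mem]
    | succ n ih =>
      constructor
      · push_cast
        rw [Pi.single_add]
        exact P.add_mem ih.1 (hst _ (hsg i))
      · push_cast
        rw [neg_add, Pi.single_add]
        refine P.add_mem ih.2 (hst _ ?_)
        rw [Pi.single_neg]
        exact IsStep_neg (hsg i)
  have hx : x ∈ P := by
    rw [← Finset.univ_sum_single x]
    refine P.sum_mem fun i _ => ?_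
    rcases Int.eq_nat_or_neg (x i) with ⟨n, hn | hn⟩
    · rw [hn]; exact (hsingle i n).1
    · rw [hn]; exact (hsingle i n).2
  exact hx

lemma Hpaths_nonempty (x : Pt d) : (Hpaths x).Nonempty := by
  classical
  have hex : ∃ n, ∃ γ : List (Pt d), IsPath γ ∧ disp γ = x ∧ γ.length = n := by
    obtain ⟨γ, h1, h2⟩ := exists_path x
    exact ⟨_, γ, h1, h2, rfl⟩
  obtain ⟨γ, h1, h2, h3⟩ := Nat.find_spec hex
  refine ⟨γ, h1, h2, ?_⟩
  unfold locTime
  rw [Finset.card_eq_one]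
  refine ⟨γ.length, ?_⟩
  ext k
  simp only [Finset.mem_filter, Finset.mem_range, Finset.mem_singleton]
  constructor
  · rintro ⟨hk, hp⟩
    by_contra hne
    have hlt : k < Nat.find hex := by omega
    refine Nat.find_min hex hlt ⟨γ.take k, fun s hs => h1 s (List.mem_of_mem_take hs), hp, ?_⟩
    simp; omega
  · rintro rfl
    exact ⟨by omega, by simpa [pos, disp] using h2⟩

lemma PotE_ne_top {φ : ℕ → ℝ≥0∞} (hφ : ∀ n, φ n ≠ ⊤) (γ : List (Pt d)) : PotE φ γ ≠ ⊤ := by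
  unfold PotE
  exact ENNReal.sum_ne_top.2 fun x _ => hφ _

lemma flr_inr (h x : Fin d → ℝ) {M : ℝ} :
    M * inr h x - ∑ i, |h i| ≤ inr h (ctR (flr M x)) := by
  unfold inr ctR flr
  rw [Finset.mul_sum, ← Finset.sum_sub_distrib]
  refine Finset.sum_le_sum fun i _ => ?_
  have h1 := Int.floor_le (M * x i)
  have h2 := Int.lt_floor_add_one (M * x i)
  have h3 : |h i * (M * x i - ⌊M * x i⌋)| ≤ |h i| := by
    rw [abs_mul]
    have : |M * x i - ⌊M * x i⌋| ≤ 1 := by rw [abs_le]; constructor <;> linarith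
    nlinarith [abs_nonneg (h i)]
  have := (abs_le.1 h3).2
  nlinarith

lemma attractive (hd : 1 ≤ d) (φ : ℕ → ℝ≥0∞) (h0 : φ 0 = 0) (hm : Monotone φ)
    (hfin : ∀ n, φ n ≠ ⊤)
    (hA : ∀ l m : ℕ, φ (l + m) ≤ φ l + φ m) (lam0 lam : ℝ) (hlam : lam0 < lam)
    (h x : Fin d → ℝ) (ξ : ℝ)
    (hξ : Filter.Tendsto (fun M : ℝ => -Real.log (HEf φ lam (flr M x)).toReal / M)
        Filter.atTop (nhds ξ)) (hx : ξ < inr h x) :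
    ∃ lam : ℝ, lam0 < lam ∧ ∃ c : ℝ, 0 < c ∧ ∀ n : ℕ, 1 ≤ n →
      c * Real.exp (lam * n) ≤ (ZHE d φ h n).toReal := by
  have hsup : ∀ n m, ZHE d φ h n * ZHE d φ h m ≤ ZHE d φ h (n + m) := by
    intro n m
    rw [ZHE_eq, ZHE_eq, ZHE_eq, ← one_mul (∑' γ : PathsN d (n+m), wt φ 0 h γ.1)]
    refine G2 (fun x y => x ++ y) 1 ?_ ?_
    · rintro a ⟨ha, hal⟩ b ⟨hb, hbl⟩
      refine ⟨⟨IsPath_append.2 ⟨ha, hb⟩, by simp [hal, hbl]⟩, ?_⟩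
      unfold wt
      rw [tilt_append, one_mul]
      have := expNegE_anti (PotE_appendA h0 hm hA a b)
      rw [expNegE_add] at this
      calc _ = (expNegE (PotE φ a) * expNegE (PotE φ b)) * (tilt 0 h a * tilt 0 h b) := by ring
        _ ≤ _ := by gcongr
    · rintro a ha b hb a' ha' b' hb' hab
      exact List.append_inj hab (ha.2.trans ha'.2.symm)
  have hpos : ∀ n, 0 < (ZHE d φ h n).toReal := by
    intro n
    refine ENNReal.toReal_pos ?_ (ZHE_ne_top φ h n)
    obtain ⟨L, ρ, e, he, hLe, -⟩ := exists_dir (0 : Fin d → ℝ) ⟨0, hd⟩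
    rw [ZHE_eq]
    intro hz
    have := ENNReal.tsum_eq_zero.1 hz ⟨List.replicate n e, straight_mem e he n⟩
    exact wt_ne_zero (PotE_ne_top hfin _) _ _ this
  have hex : ∃ n0 : ℕ, 1 ≤ n0 ∧ Real.exp (lam0 * n0) < (ZHE d φ h n0).toReal := by
    by_contra hcon
    push Not at hcon
    have hle : ∀ n, ZHE d φ h n ≤ ENNReal.ofReal (Real.exp (lam0 * n)) := by
      intro n
      rcases Nat.eq_zero_or_pos n with rfl | hn
      · have hs : PathsN d 0 ⊆ {[]} := fun γ hγ => List.eq_nil_of_length_eq_zero hγ.2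
        rw [ZHE_eq]
        refine (ENNReal.tsum_mono_subtype (wt φ 0 h) hs).trans ?_
        rw [tsum_singleton]
        refine (wt_le_tilt _ _ _ _).trans ?_
        simp [tilt, disp, inr, ctR]
      · rw [← ENNReal.ofReal_toReal (ZHE_ne_top φ h n)]
        exact ENNReal.ofReal_le_ofReal (hcon n hn)
    set C := ∑' n : ℕ, Real.exp (-(lam - lam0)) ^ n with hC
    have hsm : Summable fun n : ℕ => Real.exp (-(lam - lam0)) ^ n :=
      summable_geometric_of_lt_one (Real.exp_pos _).le (by simpa using hlam)
    have htot : ∑' n : ℕ, ∑' γ : PathsN d n, wt φ lam h γ.1 ≤ ENNReal.ofReal C := by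
      rw [hC, ENNReal.ofReal_tsum_of_nonneg (fun n => by positivity) hsm]
      refine ENNReal.tsum_le_tsum fun n => ?_
      have : ∑' γ : PathsN d n, wt φ lam h γ.1 =
          ENNReal.ofReal (Real.exp (-(lam * n))) * ZHE d φ h n := by
        rw [ZHE_eq, ← ENNReal.tsum_mul_left]
        refine tsum_congr fun γ => ?_
        rw [wt_split, γ.2.2]
      rw [this]
      calc _ ≤ ENNReal.ofReal (Real.exp (-(lam * n))) * ENNReal.ofReal (Real.exp (lam0 * n)) := by
            gcongr; exact hle n
        _ = _ := by
          rw [← ENNReal.ofReal_mul (Real.exp_pos _).le, ← Real.exp_add, ← Real.exp_nat_mul]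
          congr 2; ring
    have hH : ∀ y : Pt d, ENNReal.ofReal (Real.exp (inr h (ctR y))) * HEf φ lam y ≤ ENNReal.ofReal C := by
      intro y
      refine le_trans ?_ htot
      have h3 := G3 (fun _ : Unit => Hpaths y) (PathsN d) List.length (wt φ lam h)
        (fun _ _ _ _ _ => rfl) (fun _ γ hγ => ⟨hγ.1, rfl⟩)
      rw [tsum_fintype] at h3
      simp only [Finset.univ_unique, Finset.sum_const, Finset.card_singleton, one_smul] at h3
      refine le_trans (le_of_eq ?_) h3
      unfold HEf
      rw [← ENNReal.tsum_mul_left]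
      refine tsum_congr fun γ => ?_
      unfold wE wt tilt
      rw [Real.exp_add, ENNReal.ofReal_mul (Real.exp_pos _).le, γ.2.2.1]
      ring
    have hCpos : 0 < C := by
      have := hsm.sum_le_tsum {0} (fun _ _ => by positivity)
      rw [Finset.sum_singleton, pow_zero] at this
      exact lt_of_lt_of_le one_pos this
    have hHt : ∀ y : Pt d, HEf φ lam y ≠ ⊤ := by
      intro y hy
      have := hH y
      rw [hy, ENNReal.mul_top (by simp [Real.exp_pos]), top_le_iff] at this
      exact ENNReal.ofReal_ne_top this
    have hH0 : ∀ y : Pt d, HEf φ lam y ≠ 0 := by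
      intro y hy
      obtain ⟨γ, hγ⟩ := Hpaths_nonempty y
      have := ENNReal.tsum_eq_zero.1 hy ⟨γ, hγ⟩
      rw [wE_eq] at this
      exact wt_ne_zero (PotE_ne_top hfin _) _ _ this
    have hlog : ∀ y : Pt d, Real.log (HEf φ lam y).toReal ≤ Real.log C - inr h (ctR y) := by
      intro y
      have h2 := ENNReal.toReal_mono ENNReal.ofReal_ne_top (hH y)
      rw [ENNReal.toReal_mul, ENNReal.toReal_ofReal (Real.exp_pos _).le,
        ENNReal.toReal_ofReal hCpos.le] at h2
      have hp := ENNReal.toReal_pos (hH0 y) (hHt y)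
      have h3 := Real.log_le_log (by positivity) h2
      rw [Real.log_mul (Real.exp_pos _).ne' hp.ne', Real.log_exp] at h3
      linarith
    have hbound : ∀ᶠ M : ℝ in atTop, inr h x - (∑ i, |h i| + Real.log C) / M ≤
        -Real.log (HEf φ lam (flr M x)).toReal / M := by
      filter_upwards [eventually_gt_atTop 0] with M hM
      have h2 := hlog (flr M x)
      have h3 := flr_inr h x (M := M)
      rw [le_div_iff₀ hM, sub_mul, div_mul_cancel₀ _ hM.ne']
      linarith
    have hlim : Tendsto (fun M : ℝ => inr h x - (∑ i, |h i| + Real.log C) / M) atTop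
        (𝓝 (inr h x - 0)) :=
      tendsto_const_nhds.sub (tendsto_const_nhds.div_atTop tendsto_id)
    have := le_of_tendsto_of_tendsto hlim hξ hbound
    linarith
  obtain ⟨n0, hn0, hgt⟩ := hex
  refine growth (fun n => (ZHE d φ h n).toReal) (fun n m => ?_) (hpos 1) lam0 n0 hn0 hgt
  have := ENNReal.toReal_mono (ZHE_ne_top φ h (n+m)) (hsup n m)
  rwa [ENNReal.toReal_mul] at this

end Aux4


/-- ballistic behaviour: in the repulsive case with `h ≠ 0`, or in the
attractive case with (SL) and `h ∉ K_{λ₀}`, there are `v̄ ≠ 0`, `κ > 0` and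
`ε ∈ (0, ‖v̄‖)` such that `P_n^h(D(γ)/n ∉ B_ε(v̄)) ≤ e^{-κn}` for all `n` (stated in the
multiplied-out form). -/
theorem stmt13 (d : ℕ) (hd : 1 ≤ d) (φ : ℕ → ℝ≥0∞)
    (hN0 : φ 0 = 0) (hNmono : Monotone φ)
    (lam0 : ℝ)
    (hlam0 : Filter.Tendsto (fun n : ℕ => Real.log (ZE d φ n).toReal / n) Filter.atTop
      (nhds lam0))
    (ξ : ℝ → (Fin d → ℝ) → ℝ)
    (hξ : ∀ lam : ℝ, lam0 < lam → ∀ x : Fin d → ℝ,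
      Filter.Tendsto (fun M : ℝ => -Real.log (HEf φ lam (flr M x)).toReal / M)
        Filter.atTop (nhds (ξ lam x)))
    (h : Fin d → ℝ)
    (hcase : ((∀ l m : ℕ, φ l + φ m ≤ φ (l + m)) ∧ h ≠ 0) ∨
      ((∀ l m : ℕ, φ (l + m) ≤ φ l + φ m) ∧ SLE φ ∧
        h ∉ ⋂ lam ∈ Set.Ioi lam0, Kset (ξ lam))) :
    ∃ v : Fin d → ℝ, v ≠ 0 ∧ ∃ κ : ℝ, 0 < κ ∧ ∃ ε : ℝ, 0 < ε ∧ ε < nrm v ∧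
      ∀ n : ℕ,
        (∑' γ : {γ : List (Pt d) // γ ∈ PathsN d n ∧
            ε ≤ nrm (fun i => (disp γ i : ℝ) / n - v i)}, wHE φ h (γ : List (Pt d)))
          ≤ ENNReal.ofReal (Real.exp (-(κ * n))) * ZHE d φ h n := by
  by_cases hφ1 : φ 1 = ⊤
  · have hz : ∀ γ : List (Pt d), wHE φ h γ = 0 := by
      intro γ
      have hp : PotE φ γ = ⊤ := by
        rw [PotE_eq, ← top_le_iff, ← hφ1, ← pot_sing φ (0 : Pt d)]
        refine pot_mono hN0 hNmono ?_
        simp [vis]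
      simp [wHE, hp, expNegE]
    refine ⟨fun _ => 1, ?_, 1, one_pos, 1 / 2, by norm_num, ?_, ?_⟩
    · intro hv
      have := congrFun hv ⟨0, hd⟩
      simp at this
    · unfold nrm
      have h1 : (1 : ℝ) ≤ d := by exact_mod_cast hd
      rw [Real.lt_sqrt (by norm_num)]
      simp
      linarith
    · intro n
      simp [hz]
  · refine finish φ hN0 hφ1 lam0 hlam0 h ?_
    rcases hcase with ⟨hR, hh⟩ | ⟨hA, hSL, hK⟩
    · exact repulsive hd φ hN0 hφ1 hR lam0 hlam0 h hh
    · simp only [Set.mem_iInter, not_forall] at hK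
      obtain ⟨lam, hlam, hK⟩ := hK
      unfold Kset at hK
      rw [Set.mem_ofPred_eq] at hK
      push Not at hK
      obtain ⟨x, hx⟩ := hK
      exact attractive hd φ hN0 hNmono hSL.1 hA lam0 lam hlam h x (ξ lam x) (hξ lam hlam x) hx
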